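/- arXiv:math/0401365 — 2 statements merged into one kernel-verified Lean document; each statement's English description precedes it below -/
import Mathlib

section
/- Let v₁, v₂ be a basis of a full-rank lattice L in ℝ² × {0} ⊂ ℝ³, let h > 0, set v₃ = (v₁ + v₂)/2 + (0,0,h), let Λ be the lattice generated by v₁, v₂, v₃, let S be the covolume of L, and define, for t > 0, P(t) = ((Sh/2)/(4πt)^{3/2}) ∑_{v∈Λ} e^{−‖v‖²/(4t)} + (S/(16πt)) ∑_{(m,n)∈ℤ²} e^{−‖(m + 1/2)v₁ + n v₂‖²/(4t)} + (S/(16πt)) ∑_{(m,n)∈ℤ²} e^{−‖m v₁ + (n + 1/2)v₂‖²/(4t)}. If two such data sets (v₁, v₂, h) and (v₁', v₂', h') (with lattices L, L') yield P(t) = P'(t) for all t > 0, then h = h' and there exists a linear isometry O of ℝ² with O(L) = L' and O((v₁ + v₂)/2) ∈ (v₁' + v₂')/2 + L'. -/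
open Real

/-- Orthogonal projection `ℝ³ → ℝ²` onto the first two coordinates, identifying the plane
`ℝ² × {0}` with `ℝ²`. -/
noncomputable def planeProj (v : EuclideanSpace ℝ (Fin 3)) : EuclideanSpace ℝ (Fin 2) :=
  (WithLp.equiv 2 (Fin 2 → ℝ)).symm ![v 0, v 1]

/-- The trace function `tr(H_{N₂})` of the non-orientable flat 3-manifold `N₂`, whose covering
torus lattice is generated by the plane vectors `v₁, v₂` and `v₃ = (v₁+v₂)/2 + (0,0,h)`;
`S = |v₁ 0 * v₂ 1 − v₁ 1 * v₂ 0|` is the covolume of the plane lattice generated by `v₁, v₂`,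
and `vol(N₂) = S h / 2` (Theorem A). -/
noncomputable def N2trace (v₁ v₂ : EuclideanSpace ℝ (Fin 3)) (h t : ℝ) : ℝ :=
  (|v₁ 0 * v₂ 1 - v₁ 1 * v₂ 0| * h / 2) / (4 * π * t) ^ ((3:ℝ)/2) *
    (∑' v : (Submodule.span ℤ
        ({v₁, v₂, (1/2 : ℝ) • (v₁ + v₂) + h • EuclideanSpace.single 2 1} :
          Set (EuclideanSpace ℝ (Fin 3)))),
      Real.exp (-‖(v : EuclideanSpace ℝ (Fin 3))‖ ^ 2 / (4 * t))) +
  |v₁ 0 * v₂ 1 - v₁ 1 * v₂ 0| / (16 * π * t) *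
    (∑' p : ℤ × ℤ, Real.exp (-‖((p.1 : ℝ) + 1/2) • v₁ + (p.2 : ℝ) • v₂‖ ^ 2 / (4 * t))) +
  |v₁ 0 * v₂ 1 - v₁ 1 * v₂ 0| / (16 * π * t) *
    (∑' p : ℤ × ℤ, Real.exp (-‖(p.1 : ℝ) • v₁ + ((p.2 : ℝ) + 1/2) • v₂‖ ^ 2 / (4 * t)))

open Filter Topology

section ExponentialSums

variable {ι : Type*}

lemma finite_sublevel_of_summable_exp {f : ι → ℝ} (hf : Summable fun i => exp (-f i)) (C : ℝ) :
    {i | f i ≤ C}.Finite := by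
  have h := hf.tendsto_cofinite_zero.eventually_lt_const (exp_pos (-C))
  rw [eventually_cofinite] at h
  refine h.subset fun i hi => ?_
  simp only [Set.mem_ofPred_eq, exp_lt_exp, not_lt, neg_le_neg_iff] at hi ⊢
  exact hi

/-- The number of indices at which `f` takes the value `ν`. -/
noncomputable def fiberCount (f : ι → ℝ) (ν : ℝ) : ℝ := ({i | f i = ν}.ncard : ℝ)

lemma hasSum_fiberCount {f : ι → ℝ} {s : ℝ} (hf : Summable fun i => exp (-(s * f i))) :
    HasSum (fun ν => fiberCount f ν * exp (-(s * ν))) (∑' i, exp (-(s * f i))) := by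
  have h := hf.hasSum.tsum_fiberwise f
  refine (congrArg (HasSum · _) (funext fun ν => ?_)).mpr h
  have : ∀ b : f ⁻¹' {ν}, exp (-(s * f b)) = exp (-(s * ν)) := fun b => by rw [b.2]
  rw [tsum_congr this, tsum_const, nsmul_eq_mul]
  rfl

lemma finite_support_fiberCount {f : ι → ℝ} (hf : Summable fun i => exp (-f i)) (C : ℝ) :
    {ν | ν ≤ C ∧ fiberCount f ν ≠ 0}.Finite := by
  refine ((finite_sublevel_of_summable_exp hf C).image f).subset ?_
  rintro ν ⟨hν, h0⟩
  have : {i | f i = ν}.Nonempty := by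
    by_contra hne
    rw [Set.not_nonempty_iff_eq_empty] at hne
    simp [fiberCount, hne] at h0
  obtain ⟨i, rfl⟩ := this
  exact ⟨i, hν, rfl⟩

lemma exists_tendsto_leading_term {a : ℝ → ℝ}
    (hs : ∀ s > 0, Summable fun ν => a ν * exp (-(s * ν)))
    (hfin : ∀ C, {ν | ν ≤ C ∧ a ν ≠ 0}.Finite) (ha : a ≠ 0) :
    ∃ μ c, c ≠ 0 ∧
      Tendsto (fun s => exp (s * μ) * ∑' ν, a ν * exp (-(s * ν))) atTop (𝓝 c) := by
  obtain ⟨ν₀, h₀⟩ := Function.ne_iff.1 ha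
  obtain ⟨μ, ⟨hμ₀, hμ⟩, hmin⟩ := (hfin ν₀).exists_minimalFor id _ ⟨ν₀, le_rfl, h₀⟩
  have hlow : ∀ ν < μ, a ν = 0 := fun ν hν => by
    by_contra h
    exact absurd (hmin ⟨hν.le.trans hμ₀, h⟩ hν.le) (not_le.2 hν)
  refine ⟨μ, a μ, hμ, ?_⟩
  have key : Tendsto (fun s => ∑' ν, a ν * exp (-(s * (ν - μ)))) atTop
      (𝓝 (∑' ν, if ν = μ then a μ else 0)) := by
    refine tendsto_tsum_of_dominated_convergence
      (bound := fun ν => ‖a ν * exp (-(1 * ν))‖ * exp μ) ?_ ?_ ?_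
    · exact (hs 1 one_pos).norm.mul_right _
    · intro ν
      rcases lt_trichotomy ν μ with h | h | h
      · simp [hlow ν h, h.ne]
      · simp [h]
      · rw [if_neg h.ne']
        have : Tendsto (fun s : ℝ => exp (-(s * (ν - μ)))) atTop (𝓝 0) :=
          tendsto_exp_neg_atTop_nhds_zero.comp
            (tendsto_id.atTop_mul_const (sub_pos.2 h))
        simpa using this.const_mul (a ν)
    · filter_upwards [eventually_ge_atTop 1] with s h1 ν
      rcases lt_or_ge ν μ with h | h
      · simp [hlow ν h]
      · rw [norm_mul, norm_mul, norm_of_nonneg (exp_pos _).le, norm_of_nonneg (exp_pos _).le,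
          mul_assoc, ← exp_add]
        gcongr
        nlinarith
  rw [tsum_ite_eq] at key
  refine key.congr fun s => ?_
  rw [← tsum_mul_left]
  refine tsum_congr fun ν => ?_
  rw [mul_left_comm, ← exp_add]
  ring_nf

lemma eq_zero_of_add_div_sqrt_eq_zero {a b : ℝ → ℝ}
    (ha : ∀ s > 0, Summable fun ν => a ν * exp (-(s * ν)))
    (hb : ∀ s > 0, Summable fun ν => b ν * exp (-(s * ν)))
    (hfa : ∀ C, {ν | ν ≤ C ∧ a ν ≠ 0}.Finite) (hfb : ∀ C, {ν | ν ≤ C ∧ b ν ≠ 0}.Finite)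
    (h : ∀ s > 0, ∑' ν, a ν * exp (-(s * ν)) + (∑' ν, b ν * exp (-(s * ν))) / √s = 0) :
    a = 0 ∧ b = 0 := by
  have hsqrt : Tendsto (fun s : ℝ => (√s)⁻¹) atTop (𝓝 0) :=
    tendsto_inv_atTop_zero.comp tendsto_sqrt_atTop
  by_cases ha0 : a = 0
  · refine ⟨ha0, ?_⟩
    by_contra hb0
    obtain ⟨μ, c, hc, hlim⟩ := exists_tendsto_leading_term hb hfb hb0
    refine hc (tendsto_nhds_unique hlim (tendsto_const_nhds.congr' ?_))
    filter_upwards [eventually_gt_atTop 0] with s hs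
    have := h s hs
    have h1 : √s ≠ 0 := (sqrt_pos.2 hs).ne'
    have h2 : (∑' ν, b ν * exp (-(s * ν))) = 0 := by simpa [ha0, h1] using this
    rw [h2, mul_zero]
  exfalso
  obtain ⟨μ, c, hc, hlim⟩ := exists_tendsto_leading_term ha hfa ha0
  by_cases hb0 : b = 0
  · refine hc (tendsto_nhds_unique hlim (tendsto_const_nhds.congr' ?_))
    filter_upwards [eventually_gt_atTop 0] with s hs
    have := h s hs
    have h2 : (∑' ν, a ν * exp (-(s * ν))) = 0 := by simpa [hb0] using this
    rw [h2, mul_zero]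
  obtain ⟨μ', c', hc', hlim'⟩ := exists_tendsto_leading_term hb hfb hb0
  rcases le_or_gt μ μ' with hle | hlt
  · refine hc (tendsto_nhds_unique hlim ?_)
    have h1 : Tendsto (fun s : ℝ => -(exp (s * μ') * ∑' ν, b ν * exp (-(s * ν))) * (√s)⁻¹) atTop
        (𝓝 0) := by simpa using hlim'.neg.mul hsqrt
    refine squeeze_zero_norm' ?_ (by simpa using h1.norm)
    filter_upwards [eventually_gt_atTop 0] with s hs
    have h2 := eq_neg_of_add_eq_zero_left (h s hs)
    rw [h2, div_eq_mul_inv]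
    simp only [norm_mul, norm_neg, norm_of_nonneg (exp_pos _).le, ← mul_assoc, norm_eq_abs]
    rw [abs_inv]
    gcongr
  · refine hc' (tendsto_nhds_unique hlim' ?_)
    have h0 : Tendsto (fun s : ℝ => s ^ (1 / 2 : ℝ) * exp (-(μ - μ') * s)) atTop (𝓝 0) :=
      tendsto_rpow_mul_exp_neg_mul_atTop_nhds_zero _ _ (sub_pos.2 hlt)
    have h1 := (h0.mul hlim).neg
    rw [zero_mul, neg_zero] at h1
    refine h1.congr' ?_
    filter_upwards [eventually_gt_atTop 0] with s hs
    have h2 := eq_neg_of_add_eq_zero_left (h s hs)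
    have h3 : √s ≠ 0 := (sqrt_pos.2 hs).ne'
    rw [h2, ← sqrt_eq_rpow]
    have h4 : exp (s * μ') = exp (-(μ - μ') * s) * exp (s * μ) := by
      rw [← exp_add]; ring_nf
    rw [h4]
    field_simp

lemma finite_support_sub {a b : ℝ → ℝ} (ha : ∀ C, {ν | ν ≤ C ∧ a ν ≠ 0}.Finite)
    (hb : ∀ C, {ν | ν ≤ C ∧ b ν ≠ 0}.Finite) (A B C : ℝ) :
    {ν | ν ≤ C ∧ A * a ν - B * b ν ≠ 0}.Finite := by
  refine ((ha C).union (hb C)).subset ?_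
  rintro ν ⟨hν, h⟩
  by_cases h1 : a ν = 0
  · right
    refine ⟨hν, fun h2 => h ?_⟩
    rw [h1, h2]; ring
  · exact Or.inl ⟨hν, h1⟩

lemma hasSum_fiberCount_sub {ι' : Type*} {k : ι → ℝ} {k' : ι' → ℝ}
    (hk : ∀ s > 0, Summable fun i => exp (-(s * k i)))
    (hk' : ∀ s > 0, Summable fun i => exp (-(s * k' i))) (A B : ℝ) {s : ℝ} (hs : 0 < s) :
    HasSum (fun ν => (A * fiberCount k ν - B * fiberCount k' ν) * exp (-(s * ν)))
      (A * ∑' i, exp (-(s * k i)) - B * ∑' i, exp (-(s * k' i))) := by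
  simpa only [sub_mul, mul_assoc] using ((hasSum_fiberCount (hk s hs)).mul_left A).sub
    ((hasSum_fiberCount (hk' s hs)).mul_left B)

/-- A combination of exponential sums, one family of which carries an additional factor
`1 / √s`, determines the weighted multiplicities of all exponents in both families. -/
theorem fiberCount_eq_of_exp_sum_eq {ι' κ κ' : Type*} {f : ι → ℝ} {f' : ι' → ℝ} {g : κ → ℝ}
    {g' : κ' → ℝ} (hf : ∀ s > 0, Summable fun i => exp (-(s * f i)))
    (hf' : ∀ s > 0, Summable fun i => exp (-(s * f' i)))
    (hg : ∀ s > 0, Summable fun i => exp (-(s * g i)))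
    (hg' : ∀ s > 0, Summable fun i => exp (-(s * g' i))) (A A' B B' : ℝ)
    (h : ∀ s > 0, A * ∑' i, exp (-(s * f i)) + B * (∑' i, exp (-(s * g i))) / √s =
      A' * ∑' i, exp (-(s * f' i)) + B' * (∑' i, exp (-(s * g' i))) / √s) (ν : ℝ) :
    A * fiberCount f ν = A' * fiberCount f' ν ∧ B * fiberCount g ν = B' * fiberCount g' ν := by
  have key := eq_zero_of_add_div_sqrt_eq_zero
    (a := fun ν => A * fiberCount f ν - A' * fiberCount f' ν)
    (b := fun ν => B * fiberCount g ν - B' * fiberCount g' ν)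
    (fun s hs => (hasSum_fiberCount_sub hf hf' A A' hs).summable)
    (fun s hs => (hasSum_fiberCount_sub hg hg' B B' hs).summable)
    (finite_support_sub (finite_support_fiberCount (by simpa using hf 1 one_pos))
      (finite_support_fiberCount (by simpa using hf' 1 one_pos)) A A')
    (finite_support_sub (finite_support_fiberCount (by simpa using hg 1 one_pos))
      (finite_support_fiberCount (by simpa using hg' 1 one_pos)) B B')
    (fun s hs => by
      rw [(hasSum_fiberCount_sub hf hf' A A' hs).tsum_eq,
        (hasSum_fiberCount_sub hg hg' B B' hs).tsum_eq]
      linear_combination h s hs)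
  exact ⟨sub_eq_zero.1 (congrFun key.1 ν), sub_eq_zero.1 (congrFun key.2 ν)⟩

end ExponentialSums

section FiberCount

variable {ι : Type*} {f : ι → ℝ} {ν : ℝ}

lemma finite_fiber (hf : Summable fun i => exp (-f i)) (ν : ℝ) : {i | f i = ν}.Finite :=
  (finite_sublevel_of_summable_exp hf ν).subset fun _ hi => le_of_eq hi

lemma card_le_fiberCount (hf : Summable fun i => exp (-f i)) (T : Finset ι)
    (hT : ∀ i ∈ T, f i = ν) : (T.card : ℝ) ≤ fiberCount f ν := by
  rw [fiberCount, ← Set.ncard_coe_finset T]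
  exact_mod_cast Set.ncard_le_ncard (fun i hi => hT i hi) (finite_fiber hf ν)

lemma fiberCount_le_card (T : Finset ι) (hT : ∀ i, f i = ν → i ∈ T) :
    fiberCount f ν ≤ T.card := by
  rw [fiberCount, ← Set.ncard_coe_finset T]
  exact_mod_cast Set.ncard_le_ncard (fun i hi => hT i hi) T.finite_toSet

lemma fiberCount_ne_zero (hf : Summable fun i => exp (-f i)) (i : ι) : fiberCount f (f i) ≠ 0 := by
  have := card_le_fiberCount (ν := f i) hf {i} (by simp)
  rw [Finset.card_singleton, Nat.cast_one] at this
  linarith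

lemma exists_of_fiberCount_ne_zero (h : fiberCount f ν ≠ 0) : ∃ i, f i = ν := by
  by_contra! hne
  exact h (by simp [fiberCount, hne])

end FiberCount

/-- Squared length of `x u + (y + z / 2) k + (0, 0, z h)` for plane vectors `u`, `k` with
`‖u‖² = p`, `⟪u, k⟫ = β`, `‖k‖² = s`. -/
noncomputable def latticeForm (p β s h : ℝ) (v : ℤ × ℤ × ℤ) : ℝ :=
  p * v.1 ^ 2 + β * v.1 * (2 * v.2.1 + v.2.2) + s / 4 * (2 * v.2.1 + v.2.2) ^ 2 + h ^ 2 * v.2.2 ^ 2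

/-- Squared length of `(2 x + 1) u + y k` for plane vectors `u`, `k` with
`‖u‖² = p`, `⟪u, k⟫ = β`, `‖k‖² = s`. -/
noncomputable def oddForm (p β s : ℝ) (v : ℤ × ℤ) : ℝ :=
  p * (2 * v.1 + 1) ^ 2 + 2 * β * (2 * v.1 + 1) * v.2 + s * v.2 ^ 2

lemma exists_pos_mul_le_quadratic {p β s : ℝ} (hp : 0 < p) (hD : β ^ 2 < p * s) :
    ∃ ε > 0, ∀ x y : ℝ, ε * (x ^ 2 + y ^ 2) ≤ p * x ^ 2 + 2 * β * x * y + s * y ^ 2 := by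
  have hs : 0 < s := pos_of_mul_pos_right ((sq_nonneg β).trans_lt hD) hp.le
  obtain ⟨ε, hε⟩ : ∃ ε, ε = (p * s - β ^ 2) / (p + s) := ⟨_, rfl⟩
  have hε1 : ε * (p + s) = p * s - β ^ 2 := by rw [hε]; field_simp
  have hε0 : 0 < ε := by rw [hε]; exact div_pos (by linarith) (by linarith)
  have hεp : ε < p := by nlinarith [sq_nonneg β]
  refine ⟨ε, hε0, fun x y => ?_⟩
  have h1 : 0 ≤ (p - ε) * (p * x ^ 2 + 2 * β * x * y + s * y ^ 2 - ε * (x ^ 2 + y ^ 2)) := by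
    have : (p - ε) * (p * x ^ 2 + 2 * β * x * y + s * y ^ 2 - ε * (x ^ 2 + y ^ 2)) =
        ((p - ε) * x + β * y) ^ 2 + ε ^ 2 * y ^ 2 := by
      linear_combination (-y ^ 2) * hε1
    rw [this]; positivity
  have := nonneg_of_mul_nonneg_right h1 (sub_pos.2 hεp)
  linarith

lemma summable_exp_neg_mul_int_sq {c : ℝ} (hc : 0 < c) :
    Summable fun n : ℤ => exp (-(c * n ^ 2)) := by
  have h : Summable fun n : ℕ => exp (-(c * n ^ 2)) := by
    have h1 : Summable fun n : ℕ => exp (n * -c) :=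
      summable_exp_nat_mul_iff.2 (neg_neg_of_pos hc)
    refine h1.of_nonneg_of_le (fun _ => (exp_pos _).le) fun n => exp_le_exp.2 ?_
    have : (n : ℝ) ≤ n ^ 2 := by exact_mod_cast Nat.le_self_pow two_ne_zero n
    nlinarith
  exact Summable.of_nat_of_neg (by simpa using h) (by simpa using h)

lemma summable_exp_neg_oddForm {p β s : ℝ} (hp : 0 < p) (hD : β ^ 2 < p * s) {r : ℝ}
    (hr : 0 < r) : Summable fun v => exp (-(r * oddForm p β s v)) := by
  obtain ⟨ε, hε, h⟩ := exists_pos_mul_le_quadratic hp hD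
  have h1 := summable_exp_neg_mul_int_sq (mul_pos hr hε)
  refine (h1.mul_of_nonneg h1 (fun _ => (exp_pos _).le) fun _ => (exp_pos _).le).of_nonneg_of_le
    (fun _ => (exp_pos _).le) fun v => ?_
  rw [← exp_add, exp_le_exp]
  have h2 := h (2 * v.1 + 1) v.2
  have h3 : (v.1 : ℝ) ^ 2 ≤ (2 * v.1 + 1) ^ 2 := by
    have : 0 ≤ (3 * v.1 + 1) * (v.1 + 1) := by
      rcases le_or_gt 0 v.1 with h | h
      · positivity
      · exact mul_nonneg_of_nonpos_of_nonpos (by omega) (by omega)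
    have : (0 : ℝ) ≤ (3 * v.1 + 1) * (v.1 + 1) := by exact_mod_cast this
    linarith
  have h4 : ε * ((v.1 : ℝ) ^ 2 + v.2 ^ 2) ≤ oddForm p β s v := by
    refine le_trans ?_ h2
    gcongr
  nlinarith [mul_le_mul_of_nonneg_left h4 hr.le]

lemma summable_exp_neg_latticeForm {p β s h : ℝ} (hp : 0 < p) (hD : β ^ 2 < p * s) (hh : h ≠ 0)
    {r : ℝ} (hr : 0 < r) : Summable fun v => exp (-(r * latticeForm p β s h v)) := by
  obtain ⟨ε, hε, h1⟩ := exists_pos_mul_le_quadratic hp hD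
  have hh2 : 0 < h ^ 2 := by positivity
  obtain ⟨δ, hδ, h2⟩ := exists_pos_mul_le_quadratic (β := ε / 2) (s := ε / 4 + h ^ 2) hε
    (by nlinarith [mul_pos hε hh2])
  have hx := summable_exp_neg_mul_int_sq (mul_pos hr hε)
  have hy := summable_exp_neg_mul_int_sq (mul_pos hr hδ)
  have nn : ∀ c : ℝ, 0 ≤ fun n : ℤ => exp (-(c * n ^ 2)) := fun _ _ => (exp_pos _).le
  refine (hx.mul_of_nonneg (hy.mul_of_nonneg hy (nn _) (nn _)) (nn _)
    fun _ => by positivity).of_nonneg_of_le (fun _ => (exp_pos _).le) fun v => ?_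
  rw [← exp_add, ← exp_add, exp_le_exp]
  have h3 := h1 v.1 (v.2.1 + v.2.2 / 2)
  have h4 := h2 v.2.1 v.2.2
  have h5 : ε * (v.1 : ℝ) ^ 2 + δ * (v.2.1 ^ 2 + v.2.2 ^ 2) ≤ latticeForm p β s h v := by
    unfold latticeForm
    linarith
  nlinarith [mul_le_mul_of_nonneg_left h5 hr.le]

lemma latticeForm_eq_zero_iff {p β s h : ℝ} (hp : 0 < p) (hD : β ^ 2 < p * s) (hh : h ≠ 0)
    {v : ℤ × ℤ × ℤ} : latticeForm p β s h v = 0 ↔ v = 0 := by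
  refine ⟨fun h0 => ?_, fun h0 => by simp [h0, latticeForm]⟩
  obtain ⟨ε, hε, h1⟩ := exists_pos_mul_le_quadratic hp hD
  have h3 := h1 v.1 (v.2.1 + v.2.2 / 2)
  have h4 : latticeForm p β s h v = (p * (v.1 : ℝ) ^ 2 + 2 * β * v.1 * (v.2.1 + v.2.2 / 2) +
      s * (v.2.1 + v.2.2 / 2 : ℝ) ^ 2) + h ^ 2 * v.2.2 ^ 2 := by unfold latticeForm; ring
  have hh2 : 0 < h ^ 2 := by positivity
  have e1 : 0 ≤ ε * (v.1 : ℝ) ^ 2 := by positivity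
  have e2 : 0 ≤ ε * (v.2.1 + v.2.2 / 2 : ℝ) ^ 2 := by positivity
  have e3 : 0 ≤ h ^ 2 * (v.2.2 : ℝ) ^ 2 := by positivity
  have hz : (v.2.2 : ℝ) = 0 := by
    have : h ^ 2 * (v.2.2 : ℝ) ^ 2 = 0 := by linarith
    simpa [hh] using this
  have hx : (v.1 : ℝ) = 0 := by
    have : ε * (v.1 : ℝ) ^ 2 = 0 := by linarith
    simpa [hε.ne'] using this
  have hy : (v.2.1 : ℝ) = 0 := by
    have : ε * (v.2.1 + v.2.2 / 2 : ℝ) ^ 2 = 0 := by linarith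
    simpa [hε.ne', hz] using this
  ext <;> simp_all

section IntSquares

lemma one_le_cast_sq {x : ℤ} (hx : x ≠ 0) : (1 : ℝ) ≤ (x : ℝ) ^ 2 := by
  have : 1 ≤ x ^ 2 := by
    rcases (by omega : 1 ≤ x ∨ x ≤ -1) with h | h <;> nlinarith
  exact_mod_cast this

lemma four_le_cast_sq {x : ℤ} (h0 : x ≠ 0) (h1 : x ≠ 1) (h2 : x ≠ -1) : (4 : ℝ) ≤ (x : ℝ) ^ 2 := by
  have : 4 ≤ x ^ 2 := by
    rcases (by omega : 2 ≤ x ∨ x ≤ -2) with h | h <;> nlinarith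
  exact_mod_cast this

lemma nine_le_cast_sq {x : ℤ} (hx : x % 2 = 1) (h1 : x ≠ 1) (h2 : x ≠ -1) :
    (9 : ℝ) ≤ (x : ℝ) ^ 2 := by
  have : 9 ≤ x ^ 2 := by
    rcases (by omega : 3 ≤ x ∨ x ≤ -3) with h | h <;> nlinarith
  exact_mod_cast this

end IntSquares

section RectangularForms

variable {a c d : ℝ}

/-- The face-centred orthorhombic form attached to a rectangular plane lattice. -/
noncomputable def rectForm (a c d : ℝ) (v : ℤ × ℤ × ℤ) : ℝ :=
  a * ((v.1 + 2 * v.2.1 + v.2.2 : ℤ) : ℝ) ^ 2 + c * v.1 ^ 2 + d * v.2.2 ^ 2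

/-- The form of the lattice with doubled plane covolume that has the same odd vectors as
`rectForm`, in the basis adapted to the case `3 a ≤ c`. -/
noncomputable def longForm (a c d : ℝ) (v : ℤ × ℤ × ℤ) : ℝ :=
  a * ((v.1 + 2 * (2 * v.2.1 + v.2.2) : ℤ) : ℝ) ^ 2 + c * v.1 ^ 2 + d / 4 * v.2.2 ^ 2

/-- The form of the lattice with doubled plane covolume that has the same odd vectors as
`rectForm`, in the basis adapted to the case `c < 3 a`. -/
noncomputable def shortForm (a c d : ℝ) (v : ℤ × ℤ × ℤ) : ℝ :=
  a * ((v.1 - (2 * v.2.1 + v.2.2) : ℤ) : ℝ) ^ 2 + c * ((v.1 + (2 * v.2.1 + v.2.2) : ℤ) : ℝ) ^ 2 +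
    d / 4 * v.2.2 ^ 2

lemma le_of_rectForm_eq (ha : 0 < a) (hac : a ≤ c) (hd : 0 < d) {v : ℤ × ℤ × ℤ}
    (hv : rectForm a c d v = d) : 4 * a ≤ d ∨ a + c ≤ d := by
  obtain ⟨x, y, z⟩ := v
  simp only [rectForm] at hv
  have hX := sq_nonneg ((x + 2 * y + z : ℤ) : ℝ)
  have hx := sq_nonneg (x : ℝ)
  have aX := mul_nonneg ha.le hX
  have cx := mul_nonneg (ha.le.trans hac) hx
  by_cases hz : z = 0
  · subst hz
    by_cases hx0 : x = 0
    · subst hx0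
      have hy : y ≠ 0 := by rintro rfl; simp at hv; exact hd.ne hv
      have := one_le_cast_sq hy
      push_cast at hv
      left; nlinarith
    · rcases Int.emod_two_eq_zero_or_one x with h | h
      · have := four_le_cast_sq hx0 (by omega) (by omega)
        left; push_cast at *; nlinarith
      · have h1 := one_le_cast_sq hx0
        have h2 := one_le_cast_sq (x := x + 2 * y + 0) (by omega)
        right; push_cast at *; nlinarith
  · exfalso
    have h1 := one_le_cast_sq hz
    have h2 : a * ((x + 2 * y + z : ℤ) : ℝ) ^ 2 = 0 := by nlinarith
    have h3 : c * (x : ℝ) ^ 2 = 0 := by nlinarith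
    have h4 : x + 2 * y + z = 0 := by
      exact_mod_cast pow_eq_zero_iff two_ne_zero |>.1 ((mul_eq_zero.1 h2).resolve_left ha.ne')
    have h5 : x = 0 := by
      simpa using (mul_eq_zero.1 h3).resolve_left (ha.trans_le hac).ne'
    have h6 := four_le_cast_sq hz (by omega) (by omega)
    nlinarith

lemma rectForm_not_isospectral_shortForm (ha : 0 < a) (hac : a ≤ c) (hd : 0 < d) (hc : c < 3 * a)
    (hF : Summable fun v => exp (-rectForm a c d v))
    (hG : Summable fun v => exp (-shortForm a c d v))
    (h : ∀ ν, fiberCount (rectForm a c d) ν = fiberCount (shortForm a c d) ν) : False := by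
  have hge : a + c ≤ d := by
    have h1 : shortForm a c d (0, -1, 2) = d := by simp [shortForm]; ring
    have h2 := fiberCount_ne_zero hG (0, -1, 2)
    rw [h1, ← h] at h2
    obtain ⟨v, hv⟩ := exists_of_fiberCount_ne_zero h2
    rcases le_of_rectForm_eq ha hac hd hv with h3 | h3 <;> linarith
  have h4 : 4 ≤ fiberCount (rectForm a c d) (a + c) := by
    refine card_le_fiberCount hF {(1, 0, 0), (1, -1, 0), (-1, 0, 0), (-1, 1, 0)} ?_
    simp only [Finset.mem_insert, Finset.mem_singleton, rectForm]
    rintro v (rfl | rfl | rfl | rfl) <;> norm_num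
  have hdeq : d = a + c := by
    by_contra hne
    have hgt : a + c < d := lt_of_le_of_ne hge (Ne.symm hne)
    have h2 : fiberCount (shortForm a c d) (a + c) ≤ 2 := by
      refine fiberCount_le_card (ι := ℤ × ℤ × ℤ) {(1, 0, 0), (-1, 0, 0)} ?_
      rintro ⟨x, y, z⟩ hv
      simp only [shortForm] at hv
      obtain ⟨X, hX⟩ : ∃ X, X = x - (2 * y + z) := ⟨_, rfl⟩
      obtain ⟨W, hW⟩ : ∃ W, W = x + (2 * y + z) := ⟨_, rfl⟩
      rw [← hX, ← hW] at hv
      have aX := mul_nonneg ha.le (sq_nonneg (X : ℝ))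
      have cW := mul_nonneg (ha.le.trans hac) (sq_nonneg (W : ℝ))
      have dz := mul_nonneg hd.le (sq_nonneg (z : ℝ))
      have hz : z = 0 ∨ z = 1 ∨ z = -1 := by
        by_contra! hz
        nlinarith [four_le_cast_sq hz.1 hz.2.1 hz.2.2]
      have hW1 : W = 0 ∨ W = 1 ∨ W = -1 := by
        by_contra! hz
        nlinarith [four_le_cast_sq hz.1 hz.2.1 hz.2.2]
      have hX1 : X = 0 ∨ X = 1 ∨ X = -1 := by
        by_contra! hz
        nlinarith [four_le_cast_sq hz.1 hz.2.1 hz.2.2]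
      have hz0 : W ≠ 0 → X ≠ 0 → z = 0 := fun h1 h2 => by
        by_contra h0
        nlinarith [one_le_cast_sq h0, one_le_cast_sq h1, one_le_cast_sq h2]
      have hWX : ¬ (W = 0 ∧ X = 0 ∧ z = 0) := by
        rintro ⟨rfl, rfl, rfl⟩
        norm_num at hv
        linarith
      simp only [Finset.mem_insert, Finset.mem_singleton, Prod.mk.injEq]
      omega
    rw [← h] at h2
    linarith
  subst hdeq
  have h5 : 4 ≤ fiberCount (shortForm a c (a + c)) (5 * (a + c) / 4) := by
    refine card_le_fiberCount hG {(0, 0, 1), (0, 0, -1), (0, 1, -1), (0, -1, 1)} ?_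
    simp only [Finset.mem_insert, Finset.mem_singleton, shortForm]
    rintro v (rfl | rfl | rfl | rfl) <;> norm_num <;> ring
  have h6 : fiberCount (rectForm a c (a + c)) (5 * (a + c) / 4) ≤ 2 := by
    refine fiberCount_le_card (ι := ℤ × ℤ × ℤ) {(0, 1, 0), (0, -1, 0)} ?_
    rintro ⟨x, y, z⟩ hv
    simp only [rectForm] at hv
    obtain ⟨X, hX⟩ : ∃ X, X = x + 2 * y + z := ⟨_, rfl⟩
    rw [← hX] at hv
    have aX := mul_nonneg ha.le (sq_nonneg (X : ℝ))
    have cx := mul_nonneg (ha.le.trans hac) (sq_nonneg (x : ℝ))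
    have dz := mul_nonneg hd.le (sq_nonneg (z : ℝ))
    have hx1 : x = 0 ∨ x = 1 ∨ x = -1 := by
      by_contra! hz
      nlinarith [four_le_cast_sq hz.1 hz.2.1 hz.2.2]
    have hX1 : x ≠ 0 → X = 0 ∨ X = 1 ∨ X = -1 := fun h1 => by
      by_contra! hz
      nlinarith [four_le_cast_sq hz.1 hz.2.1 hz.2.2, one_le_cast_sq h1]
    have hz1 : z = 0 ∨ z = 1 ∨ z = -1 := by
      by_contra! hz
      nlinarith [four_le_cast_sq hz.1 hz.2.1 hz.2.2]
    have hzX : z ≠ 0 → X = 0 ∧ x = 0 := fun h1 => by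
      have h2 := one_le_cast_sq h1
      constructor
      · by_contra h0
        nlinarith [one_le_cast_sq h0]
      · by_contra h0
        nlinarith [one_le_cast_sq h0]
    have hxX : x ≠ 0 → X ≠ 0 → z = 0 → False := by
      rintro h1 h2 rfl
      have e1 : (x : ℝ) ^ 2 = 1 := by rcases hx1 with rfl | rfl | rfl <;> simp_all
      have e2 : (X : ℝ) ^ 2 = 1 := by
        rcases hX1 h1 with h | h | h
        · exact absurd h h2
        all_goals rw [h]; norm_num
      rw [e1, e2] at hv
      norm_num at hv
      linarith
    have hX2 : x = 0 → z = 0 → y = 0 ∨ y = 1 ∨ y = -1 := by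
      rintro rfl rfl
      by_contra! hz
      have e := four_le_cast_sq hz.1 hz.2.1 hz.2.2
      rw [hX] at hv
      push_cast at hv
      nlinarith
    have hne : ¬ (x = 0 ∧ y = 0 ∧ z = 0) := by
      rintro ⟨rfl, rfl, rfl⟩
      simp [hX] at hv
      linarith
    simp only [Finset.mem_insert, Finset.mem_singleton, Prod.mk.injEq]
    have hz0 : z = 0 := by
      by_contra h1
      have := hzX h1
      omega
    have hx0 : x = 0 := by
      by_contra h1
      exact hxX h1 (by omega) hz0
    have := hX2 hx0 hz0
    omega
  rw [h] at h6
  linarith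

end RectangularForms

section LongForm

variable {a c d : ℝ}

lemma sphere_longForm_subset (ha : 0 < a) (hac : 3 * a ≤ c) (hd : 4 * a ≤ d) {x y z : ℤ}
    (hv : longForm a c d (x, y, z) = a + c) (hx : x ≠ 0) :
    (x, y, z) ∈ ({(1, 0, 0), (-1, 0, 0)} : Finset (ℤ × ℤ × ℤ)) := by
  simp only [longForm] at hv
  obtain ⟨X, hX⟩ : ∃ X, X = x + 2 * (2 * y + z) := ⟨_, rfl⟩
  rw [← hX] at hv
  have aX := mul_nonneg ha.le (sq_nonneg (X : ℝ))
  have dz := mul_nonneg (show 0 ≤ d by linarith) (sq_nonneg (z : ℝ))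
  have hx1 : x = 1 ∨ x = -1 := by
    by_contra! hz
    nlinarith [four_le_cast_sq hx hz.1 hz.2]
  have e1 : (x : ℝ) ^ 2 = 1 := by rcases hx1 with rfl | rfl <;> norm_num
  have hX0 : X % 2 = 1 := by omega
  have hX1 : X = 1 ∨ X = -1 := by
    by_contra! hz
    nlinarith [nine_le_cast_sq hX0 hz.1 hz.2]
  have e2 : (X : ℝ) ^ 2 = 1 := by rcases hX1 with h | h <;> rw [h] <;> norm_num
  have hz0 : z = 0 := by
    by_contra h0
    nlinarith [one_le_cast_sq h0]
  simp only [Finset.mem_insert, Finset.mem_singleton, Prod.mk.injEq]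
  omega

lemma longForm_axis (ha : 0 < a) (hge : 4 * a ≤ d) {y z : ℤ}
    (hv : longForm a c d (0, y, z) = 4 * a) :
    d = 4 * a ∧ (y, z) ∈ ({(1, -2), (-1, 2)} : Finset (ℤ × ℤ)) := by
  simp only [longForm] at hv
  obtain ⟨Y, hY⟩ : ∃ Y, Y = 2 * y + z := ⟨_, rfl⟩
  rw [← hY] at hv
  push_cast at hv
  have aY := mul_nonneg ha.le (sq_nonneg (Y : ℝ))
  have dz := mul_nonneg (show 0 ≤ d by linarith) (sq_nonneg (z : ℝ))
  have hY1 : Y = 0 ∨ Y = 1 ∨ Y = -1 := by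
    by_contra! hz
    nlinarith [four_le_cast_sq hz.1 hz.2.1 hz.2.2]
  have hY0 : Y = 0 := by
    by_contra h0
    have hz : z ≠ 0 := by omega
    nlinarith [one_le_cast_sq h0, one_le_cast_sq hz]
  obtain ⟨w, rfl⟩ : ∃ w, z = 2 * w := ⟨-y, by omega⟩
  rw [hY0] at hv
  push_cast at hv
  have hw0 : w ≠ 0 := by
    rintro rfl
    norm_num at hv
    linarith
  have hw : w = 1 ∨ w = -1 := by
    by_contra! hz
    nlinarith [four_le_cast_sq hw0 hz.1 hz.2]
  constructor
  · have e : (w : ℝ) ^ 2 = 1 := by rcases hw with rfl | rfl <;> norm_num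
    nlinarith
  · simp only [Finset.mem_insert, Finset.mem_singleton, Prod.mk.injEq]
    omega

lemma eq_of_rectForm_isospectral_longForm (ha : 0 < a) (hlt : 3 * a < c) (hge : 4 * a ≤ d)
    (hF : Summable fun v => exp (-rectForm a c d v))
    (h : ∀ ν, fiberCount (rectForm a c d) ν = fiberCount (longForm a c d) ν) : d = 4 * a := by
  have h1 : rectForm a c d (0, 1, 0) = 4 * a := by simp [rectForm]; ring
  have h2 := fiberCount_ne_zero hF (0, 1, 0)
  rw [h1, h] at h2
  obtain ⟨⟨x, y, z⟩, hv⟩ := exists_of_fiberCount_ne_zero h2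
  by_cases hx : x = 0
  · subst hx
    exact (longForm_axis ha hge hv).1
  · exfalso
    simp only [longForm] at hv
    have dz := mul_nonneg (show 0 ≤ d by linarith) (sq_nonneg (z : ℝ))
    rcases Int.emod_two_eq_zero_or_one x with hx2 | hx2
    · have aX := mul_nonneg ha.le (sq_nonneg ((x + 2 * (2 * y + z) : ℤ) : ℝ))
      nlinarith [four_le_cast_sq hx (by omega) (by omega)]
    · nlinarith [one_le_cast_sq hx, one_le_cast_sq (x := x + 2 * (2 * y + z)) (by omega)]

lemma rectForm_not_isospectral_longForm_of_eq (ha : 0 < a) (hge : 4 * a ≤ d)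
    (hF : Summable fun v => exp (-rectForm a (3 * a) d v))
    (h : ∀ ν, fiberCount (rectForm a (3 * a) d) ν = fiberCount (longForm a (3 * a) d) ν) :
    False := by
  have h4 : 6 ≤ fiberCount (rectForm a (3 * a) d) (4 * a) := by
    have e : ({(1, 0, 0), (1, -1, 0), (-1, 0, 0), (-1, 1, 0), (0, 1, 0), (0, -1, 0)} :
        Finset (ℤ × ℤ × ℤ)).card = 6 := by decide
    refine le_of_eq_of_le (by rw [e]; norm_num) (card_le_fiberCount hF _ ?_)
    simp only [Finset.mem_insert, Finset.mem_singleton, rectForm]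
    rintro v (rfl | rfl | rfl | rfl | rfl | rfl) <;> norm_num <;> ring
  have h2 : fiberCount (longForm a (3 * a) d) (4 * a) ≤ 4 := by
    refine fiberCount_le_card (ι := ℤ × ℤ × ℤ)
      {(1, 0, 0), (-1, 0, 0), (0, 1, -2), (0, -1, 2)} ?_
    rintro ⟨x, y, z⟩ hv
    by_cases hx : x = 0
    · subst hx
      have := (longForm_axis ha hge hv).2
      simp only [Finset.mem_insert, Finset.mem_singleton, Prod.mk.injEq, true_and] at this ⊢
      omega
    · have := sphere_longForm_subset ha le_rfl hge (hv.trans (by ring)) hx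
      simp only [Finset.mem_insert, Finset.mem_singleton, Prod.mk.injEq] at this ⊢
      omega
  rw [← h] at h2
  linarith

lemma rectForm_not_isospectral_longForm_of_lt (ha : 0 < a) (hc : 3 * a < c)
    (hF : Summable fun v => exp (-rectForm a c (4 * a) v))
    (hG : Summable fun v => exp (-longForm a c (4 * a) v))
    (h : ∀ ν, fiberCount (rectForm a c (4 * a)) ν = fiberCount (longForm a c (4 * a)) ν) :
    False := by
  have hfin := finite_fiber hF (a + c)
  have hfin' := finite_fiber hG (a + c)
  set Z : Set (ℤ × ℤ × ℤ) := {v | rectForm a c (4 * a) v = a + c ∧ v.1 = 0} with hZ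
  have hZfin : Z.Finite := hfin.subset fun v hv => hv.1
  have h4 : (Z.ncard : ℝ) + 4 ≤ fiberCount (rectForm a c (4 * a)) (a + c) := by
    have hdisj : Disjoint Z
        (({(1, 0, 0), (1, -1, 0), (-1, 0, 0), (-1, 1, 0)} : Finset (ℤ × ℤ × ℤ)) : Set _) := by
      rw [Set.disjoint_left]
      rintro ⟨x, y, z⟩ ⟨-, h0⟩ h1
      simp only [Finset.coe_insert, Finset.coe_singleton, Set.mem_insert_iff,
        Set.mem_singleton_iff, Prod.mk.injEq] at h0 h1
      omega
    have h5 := Set.ncard_union_eq hdisj hZfin (Finset.finite_toSet _)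
    rw [Set.ncard_coe_finset] at h5
    have h6 : Z.ncard + 4 ≤ {v | rectForm a c (4 * a) v = a + c}.ncard := by
      refine h5.symm.trans_le (Set.ncard_le_ncard ?_ hfin)
      rintro v (hv | hv)
      · exact hv.1
      · simp only [Finset.coe_insert, Finset.coe_singleton, Set.mem_insert_iff,
          Set.mem_singleton_iff] at hv
        change rectForm a c (4 * a) v = a + c
        simp only [rectForm]
        rcases hv with rfl | rfl | rfl | rfl <;> norm_num
    rw [fiberCount]
    exact_mod_cast h6
  have h2 : fiberCount (longForm a c (4 * a)) (a + c) ≤ Z.ncard + 2 := by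
    have h5 : {v | longForm a c (4 * a) v = a + c} ⊆
        (fun v : ℤ × ℤ × ℤ => (v.1, -v.2.1, 2 * v.2.1 + v.2.2)) '' Z ∪
          (({(1, 0, 0), (-1, 0, 0)} : Finset (ℤ × ℤ × ℤ)) : Set _) := by
      rintro ⟨x, y, z⟩ hv
      by_cases hx : x = 0
      · left
        subst hx
        refine ⟨(0, -y, 2 * y + z), ⟨?_, rfl⟩, ?_⟩
        · change longForm a c (4 * a) (0, y, z) = a + c at hv
          rw [← hv]
          simp only [rectForm, longForm]
          push_cast
          ring
        · simp
      · right
        exact sphere_longForm_subset ha hc.le le_rfl hv hx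
    have h6 := (Set.ncard_le_ncard h5
      ((hZfin.image _).union (Finset.finite_toSet _))).trans (Set.ncard_union_le _ _)
    rw [Set.ncard_coe_finset] at h6
    have h7 := h6.trans (Nat.add_le_add_right (Set.ncard_image_le hZfin) _)
    unfold fiberCount
    exact_mod_cast h7
  rw [← h] at h2
  linarith

lemma rectForm_not_isospectral_longForm (ha : 0 < a) (hc : 3 * a ≤ c) (hd : 0 < d)
    (hF : Summable fun v => exp (-rectForm a c d v))
    (hG : Summable fun v => exp (-longForm a c d v))
    (h : ∀ ν, fiberCount (rectForm a c d) ν = fiberCount (longForm a c d) ν) : False := by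
  have hge : 4 * a ≤ d := by
    have h1 : longForm a c d (0, -1, 2) = d := by simp [longForm]; ring
    have h2 := fiberCount_ne_zero hG (0, -1, 2)
    rw [h1, ← h] at h2
    obtain ⟨v, hv⟩ := exists_of_fiberCount_ne_zero h2
    rcases le_of_rectForm_eq ha (by linarith) hd hv with h3 | h3 <;> linarith
  rcases hc.eq_or_lt with rfl | hlt
  · exact rectForm_not_isospectral_longForm_of_eq ha hge hF h
  · obtain rfl := eq_of_rectForm_isospectral_longForm ha hlt hge hF h
    exact rectForm_not_isospectral_longForm_of_lt ha hlt hF hG h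

end LongForm

/-- The conditions on the Gram data `p = ‖u‖²`, `β = ⟪u, k⟫`, `s = ‖k‖²` of a basis adapted to
the class of `k / 2` that single out one triple per isometry class. -/
structure IsReducedGram (p β s : ℝ) : Prop where
  pos : 0 < p
  nonneg : 0 ≤ β
  le : β ≤ p
  two_mul_le : 2 * β ≤ s
  sq_lt : β ^ 2 < p * s

namespace IsReducedGram

variable {p β s p' β' s' h h' : ℝ}

lemma le_oddForm_of_ne_zero (hr : IsReducedGram p β s) {x y : ℤ} (hy : y ≠ 0) :
    p - 2 * β + s ≤ oddForm p β s (x, y) := by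
  have h1 := one_le_cast_sq hy
  have h2 := one_le_cast_sq (x := 2 * x + 1) (by omega)
  have h3 := sq_nonneg (2 * x + 1 + y : ℝ)
  push_cast at h2
  have e1 := mul_nonneg (sub_nonneg.2 hr.le) (sub_nonneg.2 h2)
  have e2 := mul_nonneg (sub_nonneg.2 hr.two_mul_le) (sub_nonneg.2 h1)
  have e3 := mul_nonneg hr.nonneg (add_nonneg h3 (sub_nonneg.2 h1))
  simp only [oddForm]
  linarith

lemma le_oddForm (hr : IsReducedGram p β s) (v : ℤ × ℤ) : p ≤ oddForm p β s v := by
  obtain ⟨x, y⟩ := v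
  by_cases hy : y = 0
  · have h2 := one_le_cast_sq (x := 2 * x + 1) (by omega)
    push_cast at h2
    simp only [oddForm, hy]
    have := mul_nonneg hr.pos.le (sub_nonneg.2 h2)
    norm_num
    linarith
  · have := hr.le_oddForm_of_ne_zero (x := x) hy
    have := hr.two_mul_le
    linarith

lemma summable_oddForm (hr : IsReducedGram p β s) : Summable fun v => exp (-oddForm p β s v) := by
  simpa using summable_exp_neg_oddForm hr.pos hr.sq_lt one_pos

lemma summable_latticeForm (hr : IsReducedGram p β s) (hh : 0 < h) :
    Summable fun v => exp (-latticeForm p β s h v) := by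
  simpa using summable_exp_neg_latticeForm hr.pos hr.sq_lt hh.ne' one_pos

lemma eq_zero_or_eq_neg_one (hr : IsReducedGram p β s) {x : ℤ} (hx : oddForm p β s (x, 0) = p) :
    x = 0 ∨ x = -1 := by
  have hp := hr.pos
  simp only [oddForm] at hx
  by_contra! hne
  have := nine_le_cast_sq (x := 2 * x + 1) (by omega) (by omega) (by omega)
  push_cast at this
  norm_num at hx
  nlinarith

lemma fiberCount_oddForm_eq_two (hr : IsReducedGram p β s) (hs : 2 * β < s) :
    fiberCount (oddForm p β s) p = 2 := by
  refine le_antisymm ?_ ?_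
  · refine fiberCount_le_card (ι := ℤ × ℤ) {(0, 0), (-1, 0)} ?_
    rintro ⟨x, y⟩ hv
    have hy : y = 0 := by
      by_contra hy
      have := hr.le_oddForm_of_ne_zero (x := x) hy
      linarith
    subst hy
    have := hr.eq_zero_or_eq_neg_one hv
    simpa using this
  · refine card_le_fiberCount hr.summable_oddForm {(0, 0), (-1, 0)} ?_
    simp only [Finset.mem_insert, Finset.mem_singleton, oddForm]
    rintro v (rfl | rfl) <;> norm_num

lemma fiberCount_oddForm_eq_four (hr : IsReducedGram p β s) (hs : s = 2 * β) :
    fiberCount (oddForm p β s) p = 4 := by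
  subst hs
  have hβ : 0 < β := by
    have := hr.sq_lt
    have := hr.pos
    refine lt_of_le_of_ne hr.nonneg ?_
    rintro rfl
    simp at *
  refine le_antisymm ?_ ?_
  · refine fiberCount_le_card (ι := ℤ × ℤ) {(0, 0), (-1, 0), (0, -1), (-1, 1)} ?_
    rintro ⟨x, y⟩ hv
    by_cases hy : y = 0
    · subst hy
      have := hr.eq_zero_or_eq_neg_one hv
      simp only [Finset.mem_insert, Finset.mem_singleton, Prod.mk.injEq, and_true]
      omega
    · have h1 := one_le_cast_sq hy
      have h2 := one_le_cast_sq (x := 2 * x + 1) (by omega)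
      push_cast at h2
      have e1 := mul_nonneg (sub_nonneg.2 hr.le) (sub_nonneg.2 h2)
      simp only [oddForm] at hv
      have e2 : β * ((2 * x + 1 + y : ℝ) ^ 2 + (y ^ 2 - 1)) ≤ 0 := by linarith
      have e3 : (2 * x + 1 + y : ℝ) ^ 2 + (y ^ 2 - 1) ≤ 0 := nonpos_of_mul_nonpos_right e2 hβ
      have e4 : (2 * x + 1 + y) ^ 2 + (y ^ 2 - 1) ≤ 0 := by exact_mod_cast e3
      have e5 : 2 * x + 1 + y = 0 := by
        by_contra h0
        have h3 := one_le_cast_sq h0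
        push_cast at h3
        linarith
      have hy1 : y = 1 ∨ y = -1 := by
        by_contra! hne
        have h3 := four_le_cast_sq hy hne.1 hne.2
        have := sq_nonneg (2 * x + 1 + y : ℝ)
        linarith
      simp only [Finset.mem_insert, Finset.mem_singleton, Prod.mk.injEq]
      omega
  · refine card_le_fiberCount hr.summable_oddForm {(0, 0), (-1, 0), (0, -1), (-1, 1)} ?_
    simp only [Finset.mem_insert, Finset.mem_singleton, oddForm]
    rintro v (rfl | rfl | rfl | rfl) <;> norm_num

lemma le_of_support_subset (hr : IsReducedGram p β s) (hr' : IsReducedGram p' β' s')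
    (h : ∀ ν, fiberCount (oddForm p' β' s') ν ≠ 0 → fiberCount (oddForm p β s) ν ≠ 0) :
    p ≤ p' := by
  have h1 := h _ (fiberCount_ne_zero hr'.summable_oddForm (0, 0))
  obtain ⟨v, hv⟩ := exists_of_fiberCount_ne_zero h1
  refine (hr.le_oddForm v).trans_eq (hv.trans ?_)
  simp [oddForm]

lemma sub_add_le_sub_add (hr : IsReducedGram p β s) (hr' : IsReducedGram p β' s')
    (h : ∀ ν, fiberCount (oddForm p β s) ν = fiberCount (oddForm p β' s') ν) :
    p - 2 * β + s ≤ p - 2 * β' + s' := by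
  by_contra! hlt
  have h1 := h (p - 2 * β' + s')
  rw [fiberCount, fiberCount, Nat.cast_inj] at h1
  refine h1.not_lt (Set.ncard_lt_ncard ?_ (finite_fiber hr'.summable_oddForm _))
  refine Set.ssubset_iff_exists.2 ⟨?_, (0, -1), ?_, fun h2 => ?_⟩
  · rintro ⟨x, y⟩ hv
    change oddForm p β s (x, y) = _ at hv
    change oddForm p β' s' (x, y) = _
    by_cases hy : y = 0
    · rw [← hv, hy]
      simp [oddForm]
    · have := hr.le_oddForm_of_ne_zero (x := x) hy
      linarith
  · change oddForm p β' s' (0, -1) = _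
    simp [oddForm]
    ring
  · change oddForm p β s (0, -1) = _ at h2
    simp [oddForm] at h2
    linarith

lemma eq_of_fiberCount_eq (hr : IsReducedGram p β s) (hr' : IsReducedGram p β' s')
    (hD : p * s - β ^ 2 = p * s' - β' ^ 2)
    (h : ∀ ν, fiberCount (oddForm p β s) ν = fiberCount (oddForm p β' s') ν) :
    β = β' ∧ s = s' := by
  have h1 := hr.sub_add_le_sub_add hr' h
  have h2 := hr'.sub_add_le_sub_add hr fun ν => (h ν).symm
  have h3 : s = s' - 2 * β' + 2 * β := by linarith
  have h4 : (β - β') * (2 * p - β - β') = 0 := by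
    rw [h3] at hD
    linear_combination hD
  have h5 : β = β' := by
    rcases mul_eq_zero.1 h4 with h5 | h5
    · linarith
    · have := hr.le
      have := hr'.le
      linarith
  exact ⟨h5, by rw [h3, h5]; ring⟩

lemma oddForm_eq_add_of_eq_two_mul (hs : s = 2 * β) (v : ℤ × ℤ) : oddForm p β s v =
    β / 2 * ((2 * v.1 + 1 + 2 * v.2 : ℤ) : ℝ) ^ 2 +
      (p - β / 2) * ((2 * v.1 + 1 : ℤ) : ℝ) ^ 2 := by
  subst hs
  simp only [oddForm]
  push_cast
  ring

lemma sub_add_eq_of_double (hr : IsReducedGram p β s) (hr' : IsReducedGram p β' s')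
    (hs : s = 2 * β) (hs' : 2 * β' < s')
    (h : ∀ ν, fiberCount (oddForm p β s) ν = 2 * fiberCount (oddForm p β' s') ν) :
    p - 2 * β' + s' = p + 4 * β := by
  have hβ := hr.nonneg
  have hle := hr.le
  have hp := hr.pos
  refine le_antisymm ?_ ?_
  · by_contra! hlt
    have h1 := fiberCount_ne_zero hr.summable_oddForm (0, 1)
    rw [h] at h1
    obtain ⟨⟨x, y⟩, hv⟩ := exists_of_fiberCount_ne_zero (right_ne_zero_of_mul h1)
    have h2 : oddForm p β s (0, 1) = p + 4 * β := by
      simp only [oddForm, hs]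
      push_cast
      ring
    rw [h2] at hv
    have hβ' : 0 < β := by
      refine lt_of_le_of_ne hβ ?_
      rintro rfl
      have := hr.sq_lt
      simp [hs] at this
    by_cases hy : y = 0
    · subst hy
      by_cases hx : 2 * x + 1 = 1 ∨ 2 * x + 1 = -1
      · have e : (2 * x + 1 : ℝ) ^ 2 = 1 := by
          rcases hx with hx | hx
          · obtain rfl : x = 0 := by omega
            norm_num
          · obtain rfl : x = -1 := by omega
            norm_num
        simp only [oddForm, e] at hv
        norm_num at hv
        linarith
      · have := nine_le_cast_sq (x := 2 * x + 1) (by omega) (by tauto) (by tauto)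
        push_cast at this
        simp only [oddForm] at hv
        norm_num at hv
        nlinarith
    · have := hr'.le_oddForm_of_ne_zero (x := x) hy
      linarith
  · have h1 := fiberCount_ne_zero hr'.summable_oddForm (0, -1)
    have h2 : oddForm p β' s' (0, -1) = p - 2 * β' + s' := by
      simp only [oddForm]
      push_cast
      ring
    have h3 := mul_ne_zero two_ne_zero h1
    rw [← h] at h3
    obtain ⟨⟨x, y⟩, hv⟩ := exists_of_fiberCount_ne_zero h3
    rw [h2, oddForm_eq_add_of_eq_two_mul hs] at hv
    rw [← hv]
    obtain ⟨X, hX⟩ : ∃ X, X = 2 * x + 1 := ⟨_, rfl⟩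
    obtain ⟨V, hV⟩ : ∃ V, V = 2 * x + 1 + 2 * y := ⟨_, rfl⟩
    rw [← hV, ← hX] at hv ⊢
    have hX1 := one_le_cast_sq (x := X) (by omega)
    have hV1 := one_le_cast_sq (x := V) (by omega)
    have hc : 0 ≤ p - β / 2 := by linarith
    by_cases hX2 : X = 1 ∨ X = -1
    · by_cases hV2 : V = 1 ∨ V = -1
      · exfalso
        have e1 : (X : ℝ) ^ 2 = 1 := by rcases hX2 with h | h <;> simp [h]
        have e2 : (V : ℝ) ^ 2 = 1 := by rcases hV2 with h | h <;> simp [h]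
        rw [e1, e2] at hv
        linarith
      · have := nine_le_cast_sq (x := V) (by omega) (by tauto) (by tauto)
        nlinarith [mul_nonneg hc (sub_nonneg.2 hX1)]
    · have := nine_le_cast_sq (x := X) (by omega) (by tauto) (by tauto)
      nlinarith [mul_nonneg hβ (sub_nonneg.2 hV1)]

lemma false_of_double (hr : IsReducedGram p β s) (hr' : IsReducedGram p β' s')
    (hh : 0 < h) (hh' : 0 < h') (hs : s = 2 * β) (hs' : 2 * β' < s')
    (hD : p * s' - β' ^ 2 = 4 * (p * s - β ^ 2)) (hheight : h = 2 * h')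
    (hO : ∀ ν, fiberCount (oddForm p β s) ν = 2 * fiberCount (oddForm p β' s') ν)
    (hL : ∀ ν, fiberCount (latticeForm p β s h) ν = fiberCount (latticeForm p β' s' h') ν) :
    False := by
  have hβ : 0 < β := by
    refine lt_of_le_of_ne hr.nonneg ?_
    rintro rfl
    have := hr.sq_lt
    simp [hs] at this
  have hle := hr.le
  have hle' := hr'.le
  have hshort := hr.sub_add_eq_of_double hr' hs hs' hO
  obtain rfl : s' = 2 * β' + 4 * β := by linarith
  have hF : latticeForm p β s h = rectForm (β / 2) (p - β / 2) (h ^ 2) := by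
    funext v
    simp only [latticeForm, rectForm, hs]
    push_cast
    ring
  have hsF := hr.summable_latticeForm hh
  have hsG := hr'.summable_latticeForm hh'
  have hcases : (β' - p) ^ 2 = (p - 2 * β) ^ 2 := by
    rw [hs] at hD
    linear_combination -hD
  rcases le_or_gt (2 * β) p with hc | hc
  · have hβ' : β' = 2 * β := by
      rcases sq_eq_sq_iff_eq_or_eq_neg.1 hcases with h1 | h1 <;> linarith
    have hG : latticeForm p β' (2 * β' + 4 * β) h' = longForm (β / 2) (p - β / 2) (h ^ 2) := by
      funext v
      simp only [latticeForm, longForm, hβ', hheight]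
      push_cast
      ring
    rw [hF] at hsF
    rw [hG] at hsG
    rw [hF, hG] at hL
    exact rectForm_not_isospectral_longForm (by linarith) (by linarith) (by positivity) hsF hsG hL
  · have hβ' : β' = 2 * p - 2 * β := by
      rcases sq_eq_sq_iff_eq_or_eq_neg.1 hcases with h1 | h1 <;> linarith
    have hG : latticeForm p β' (2 * β' + 4 * β) h' = shortForm (β / 2) (p - β / 2) (h ^ 2) := by
      funext v
      simp only [latticeForm, shortForm, hβ', hheight]
      push_cast
      ring
    rw [hF] at hsF
    rw [hG] at hsG
    rw [hF, hG] at hL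
    exact rectForm_not_isospectral_shortForm (by linarith) (by linarith) (by positivity)
      (by linarith) hsF hsG hL

/-- A reduced Gram triple and the height are determined by the multiplicities of the lengths in
the lattice and among the odd vectors, the latter weighted by the plane covolume. -/
theorem eq_of_isospectral (hr : IsReducedGram p β s) (hr' : IsReducedGram p' β' s')
    (hh : 0 < h) (hh' : 0 < h') (hvol : √(p * s - β ^ 2) * h = √(p' * s' - β' ^ 2) * h')
    (hO : ∀ ν, √(p * s - β ^ 2) * fiberCount (oddForm p β s) ν =
      √(p' * s' - β' ^ 2) * fiberCount (oddForm p' β' s') ν)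
    (hL : ∀ ν, fiberCount (latticeForm p β s h) ν = fiberCount (latticeForm p' β' s' h') ν) :
    p = p' ∧ β = β' ∧ s = s' ∧ h = h' := by
  have hD := sqrt_pos.2 (sub_pos.2 hr.sq_lt)
  have hD' := sqrt_pos.2 (sub_pos.2 hr'.sq_lt)
  have hsq := sq_sqrt (sub_pos.2 hr.sq_lt).le
  have hsq' := sq_sqrt (sub_pos.2 hr'.sq_lt).le
  obtain rfl : p = p' := by
    refine le_antisymm (hr.le_of_support_subset hr' fun ν hν h0 => ?_)
      (hr'.le_of_support_subset hr fun ν hν h0 => ?_)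
    · exact mul_ne_zero hD'.ne' hν (by rw [← hO, h0, mul_zero])
    · exact mul_ne_zero hD.ne' hν (by rw [hO, h0, mul_zero])
  obtain ⟨δ, hδ⟩ : ∃ δ, δ = √(p * s - β ^ 2) := ⟨_, rfl⟩
  obtain ⟨δ', hδ'⟩ : ∃ δ', δ' = √(p * s' - β' ^ 2) := ⟨_, rfl⟩
  simp only [← hδ, ← hδ'] at hD hD' hsq hsq' hvol hO
  clear hδ hδ'
  have main (hδδ' : δ = δ') : p = p ∧ β = β' ∧ s = s' ∧ h = h' := by
    subst hδδ'
    have h1 := hr.eq_of_fiberCount_eq hr' (by rw [← hsq, ← hsq']) fun ν =>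
      mul_left_cancel₀ hD.ne' (hO ν)
    exact ⟨rfl, h1.1, h1.2, mul_left_cancel₀ hD.ne' hvol⟩
  rcases hr.two_mul_le.eq_or_lt with hs | hs <;> rcases hr'.two_mul_le.eq_or_lt with hs' | hs'
  · have h1 := hO p
    rw [hr.fiberCount_oddForm_eq_four hs.symm, hr'.fiberCount_oddForm_eq_four hs'.symm] at h1
    exact main (by linarith)
  · have h1 := hO p
    rw [hr.fiberCount_oddForm_eq_four hs.symm, hr'.fiberCount_oddForm_eq_two hs'] at h1
    obtain rfl : δ' = 2 * δ := by linarith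
    refine (hr.false_of_double hr' hh hh' hs.symm hs' (by rw [← hsq, ← hsq']; ring)
      (mul_left_cancel₀ hD.ne' (by linarith)) (fun ν => mul_left_cancel₀ hD.ne' ?_) hL).elim
    rw [hO]; ring
  · have h1 := hO p
    rw [hr.fiberCount_oddForm_eq_two hs, hr'.fiberCount_oddForm_eq_four hs'.symm] at h1
    obtain rfl : δ = 2 * δ' := by linarith
    refine (hr'.false_of_double hr hh' hh hs'.symm hs (by rw [← hsq, ← hsq']; ring)
      (mul_left_cancel₀ hD'.ne' (by linarith)) (fun ν => mul_left_cancel₀ hD'.ne' ?_)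
      fun ν => (hL ν).symm).elim
    rw [← hO]; ring
  · have h1 := hO p
    rw [hr.fiberCount_oddForm_eq_two hs, hr'.fiberCount_oddForm_eq_two hs'] at h1
    exact main (by linarith)

end IsReducedGram

/-- The trace function of `N₂` in terms of the Gram data `p = ‖u‖²`, `β = ⟪u, k⟫`, `s = ‖k‖²` of
an adapted basis of the plane lattice. -/
noncomputable def gramTrace (p β s h t : ℝ) : ℝ :=
  √(p * s - β ^ 2) * h / 2 / (4 * π * t) ^ ((3 : ℝ) / 2) *
    (∑' v, exp (-latticeForm p β s h v / (4 * t))) +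
  √(p * s - β ^ 2) / (16 * π * t) * (∑' v, exp (-(oddForm p β s v / 4) / (4 * t)))

section GramTrace

variable {p β s h p' β' s' h' : ℝ}

lemma gramTrace_inv (p β s h : ℝ) {σ : ℝ} (hσ : 0 < σ) :
    gramTrace p β s h (1 / (4 * σ)) = σ ^ ((3 : ℝ) / 2) *
      (√(p * s - β ^ 2) * h / (2 * π ^ ((3 : ℝ) / 2)) *
          (∑' v, exp (-(σ * latticeForm p β s h v))) +
        √(p * s - β ^ 2) / (4 * π) * (∑' v, exp (-(σ * (oddForm p β s v / 4)))) / √σ) := by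
  have e1 (r : ℝ) : -r / (4 * (1 / (4 * σ))) = -(σ * r) := by field_simp
  have e2 : 4 * π * (1 / (4 * σ)) = π / σ := by field_simp
  have e3 : σ ^ ((3 : ℝ) / 2) = σ * √σ := by
    rw [sqrt_eq_rpow, ← rpow_one_add' hσ.le (by norm_num)]
    norm_num
  have e4 : 16 * π * (1 / (4 * σ)) = 4 * π / σ := by field_simp; norm_num
  have hs := (sqrt_pos.2 hσ).ne'
  have hπ := (rpow_pos_of_pos pi_pos ((3 : ℝ) / 2)).ne'
  simp only [gramTrace, e1, e2, e4]
  rw [div_rpow pi_pos.le hσ.le, e3]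
  field_simp

/-- Equal trace functions have equal volumes, equal length multiplicities in the lattice, and
equal multiplicities among odd vectors after weighting by the plane covolume. -/
theorem fiberCount_eq_of_gramTrace_eq (hp : 0 < p) (hD : β ^ 2 < p * s) (hh : 0 < h)
    (hp' : 0 < p') (hD' : β' ^ 2 < p' * s') (hh' : 0 < h')
    (heq : ∀ t > 0, gramTrace p β s h t = gramTrace p' β' s' h' t) :
    √(p * s - β ^ 2) * h = √(p' * s' - β' ^ 2) * h' ∧
    (∀ ν, √(p * s - β ^ 2) * fiberCount (oddForm p β s) ν =
      √(p' * s' - β' ^ 2) * fiberCount (oddForm p' β' s') ν) ∧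
    ∀ ν, fiberCount (latticeForm p β s h) ν = fiberCount (latticeForm p' β' s' h') ν := by
  have hodd {p β s : ℝ} (hp : 0 < p) (hD : β ^ 2 < p * s) (r : ℝ) (hr : r > 0) :
      Summable fun v => exp (-(r * (oddForm p β s v / 4))) := by
    simpa only [div_mul_eq_mul_div, mul_div_assoc] using
      summable_exp_neg_oddForm hp hD (r := r / 4) (by positivity)
  have key := fiberCount_eq_of_exp_sum_eq
    (fun r hr => summable_exp_neg_latticeForm hp hD hh.ne' hr)
    (fun r hr => summable_exp_neg_latticeForm hp' hD' hh'.ne' hr)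
    (hodd hp hD) (hodd hp' hD')
    (√(p * s - β ^ 2) * h / (2 * π ^ ((3 : ℝ) / 2)))
    (√(p' * s' - β' ^ 2) * h' / (2 * π ^ ((3 : ℝ) / 2)))
    (√(p * s - β ^ 2) / (4 * π)) (√(p' * s' - β' ^ 2) / (4 * π)) fun σ hσ => by
      have h1 := heq (1 / (4 * σ)) (by positivity)
      rw [gramTrace_inv _ _ _ _ hσ, gramTrace_inv _ _ _ _ hσ] at h1
      exact mul_left_cancel₀ (rpow_pos_of_pos hσ _).ne' h1
  have hπ := (rpow_pos_of_pos pi_pos ((3 : ℝ) / 2))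
  have hδ := sqrt_pos.2 (sub_pos.2 hD)
  have hzero {p β s h : ℝ} (hp : 0 < p) (hD : β ^ 2 < p * s) (hh : 0 < h) :
      fiberCount (latticeForm p β s h) 0 = 1 := by
    simp only [fiberCount, latticeForm_eq_zero_iff hp hD hh.ne']
    simp
  have hvol : √(p * s - β ^ 2) * h = √(p' * s' - β' ^ 2) * h' := by
    have h1 := (key 0).1
    rw [hzero hp hD hh, hzero hp' hD' hh'] at h1
    field_simp at h1
    exact h1
  refine ⟨hvol, fun ν => ?_, fun ν => ?_⟩
  · have h1 := (key (ν / 4)).2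
    have e (p β s : ℝ) : fiberCount (fun v => oddForm p β s v / 4) (ν / 4) =
        fiberCount (oddForm p β s) ν := by
      simp only [fiberCount, div_left_inj' (four_ne_zero (α := ℝ))]
    rw [e, e] at h1
    field_simp at h1
    exact h1
  · have h1 := (key ν).1
    rw [← hvol] at h1
    exact mul_left_cancel₀ (by positivity) h1

lemma gramTrace_congr (hD : p' * s' - β' ^ 2 = p * s - β ^ 2)
    (e : ℤ × ℤ × ℤ ≃ ℤ × ℤ × ℤ) (he : ∀ v, latticeForm p β s h (e v) = latticeForm p' β' s' h v)
    (o : ℤ × ℤ ≃ ℤ × ℤ) (ho : ∀ v, oddForm p β s (o v) = oddForm p' β' s' v) (t : ℝ) :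
    gramTrace p' β' s' h t = gramTrace p β s h t := by
  simp only [gramTrace, hD, ← he, ← ho]
  rw [Equiv.tsum_eq e fun v => exp (-latticeForm p β s h v / (4 * t)),
    Equiv.tsum_eq o fun v => exp (-(oddForm p β s v / 4) / (4 * t))]

/-- Replacing `k` by `k + 2 j u` does not change the trace. -/
lemma gramTrace_shift (p β s h t : ℝ) (j : ℤ) :
    gramTrace p (β + 2 * j * p) (s + 4 * j * β + 4 * j ^ 2 * p) h t = gramTrace p β s h t := by
  refine gramTrace_congr (by ring)
    ⟨fun v => (v.1 + j * (2 * v.2.1 + v.2.2), v.2), fun v => (v.1 - j * (2 * v.2.1 + v.2.2), v.2),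
      fun v => by simp, fun v => by simp⟩ (fun v => ?_)
    ⟨fun v => (v.1 + j * v.2, v.2), fun v => (v.1 - j * v.2, v.2),
      fun v => by simp, fun v => by simp⟩ (fun v => ?_) t
  · simp only [latticeForm, Equiv.coe_fn_mk]
    push_cast
    ring
  · simp only [oddForm, Equiv.coe_fn_mk]
    push_cast
    ring

/-- Replacing `u` by `u - k` does not change the trace. -/
lemma gramTrace_sub (p β s h t : ℝ) :
    gramTrace (p - 2 * β + s) (β - s) s h t = gramTrace p β s h t := by
  refine gramTrace_congr (by ring)
    ⟨fun v => (v.1, v.2.1 - v.1, v.2.2), fun v => (v.1, v.2.1 + v.1, v.2.2),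
      fun v => by simp, fun v => by simp⟩ (fun v => ?_)
    ⟨fun v => (v.1, v.2 - (2 * v.1 + 1)), fun v => (v.1, v.2 + (2 * v.1 + 1)),
      fun v => by simp, fun v => by simp⟩ (fun v => ?_) t
  · simp only [latticeForm, Equiv.coe_fn_mk]
    push_cast
    ring
  · simp only [oddForm, Equiv.coe_fn_mk]
    push_cast
    ring

/-- Replacing `k` by `-k` does not change the trace. -/
lemma gramTrace_neg (p β s h t : ℝ) : gramTrace p (-β) s h t = gramTrace p β s h t := by
  refine gramTrace_congr (by ring)
    ⟨fun v => (v.1, -v.2.1 - v.2.2, v.2.2), fun v => (v.1, -v.2.1 - v.2.2, v.2.2),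
      fun v => by simp, fun v => by simp⟩ (fun v => ?_)
    ((Equiv.refl ℤ).prodCongr (Equiv.neg ℤ)) (fun v => ?_) t
  · simp only [latticeForm, Equiv.coe_fn_mk]
    push_cast
    ring
  · simp only [oddForm, Equiv.prodCongr_apply, Prod.map, Equiv.refl_apply, Equiv.neg_apply]
    push_cast
    ring

end GramTrace

section TraceOfBasis

variable {u w : EuclideanSpace ℝ (Fin 3)}

lemma covolume_eq_sqrt (hu : u 2 = 0) (hw : w 2 = 0) :
    |u 0 * w 1 - u 1 * w 0| = √(‖u‖ ^ 2 * ‖u + w‖ ^ 2 - inner ℝ u (u + w) ^ 2) := by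
  rw [← sqrt_sq_eq_abs]
  congr 1
  simp only [EuclideanSpace.real_norm_sq_eq, PiLp.inner_apply, Fin.sum_univ_three, PiLp.add_apply,
    hu, hw, RCLike.inner_apply, conj_trivial]
  ring

lemma norm_sq_eq_latticeForm (hu : u 2 = 0) (hw : w 2 = 0) (h : ℝ) (x y z : ℤ) :
    ‖x • u + y • (u + w) + z • ((1 / 2 : ℝ) • (u + w) + h • EuclideanSpace.single 2 1)‖ ^ 2 =
      latticeForm (‖u‖ ^ 2) (inner ℝ u (u + w)) (‖u + w‖ ^ 2) h (x, y, z) := by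
  simp only [latticeForm, EuclideanSpace.real_norm_sq_eq, PiLp.inner_apply, Fin.sum_univ_three,
    PiLp.add_apply, PiLp.smul_apply, hu, hw, RCLike.inner_apply, conj_trivial, zsmul_eq_mul,
    smul_eq_mul]
  simp
  ring

lemma norm_sq_eq_oddForm (u w : EuclideanSpace ℝ (Fin 3)) (x y : ℤ) :
    ‖(x + 1 / 2 + y / 2 : ℝ) • u + (y / 2 : ℝ) • w‖ ^ 2 =
      oddForm (‖u‖ ^ 2) (inner ℝ u (u + w)) (‖u + w‖ ^ 2) (x, y) / 4 := by
  simp only [oddForm, EuclideanSpace.real_norm_sq_eq, PiLp.inner_apply, Fin.sum_univ_three,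
    PiLp.add_apply, PiLp.smul_apply, RCLike.inner_apply, conj_trivial, smul_eq_mul]
  ring

lemma inner_sq_lt (h : LinearIndependent ℝ ![u, w]) :
    inner ℝ u (u + w) ^ 2 < ‖u‖ ^ 2 * ‖u + w‖ ^ 2 := by
  have h0 : u ≠ 0 := h.ne_zero 0
  have hw : w - (inner ℝ u w / ‖u‖ ^ 2) • u ≠ 0 := by
    intro h1
    have := LinearIndependent.pair_iff.1 h (-(inner ℝ u w / ‖u‖ ^ 2)) 1
      (by rw [one_smul, neg_smul, ← h1]; abel)
    exact one_ne_zero this.2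
  have hu := norm_pos_iff.2 h0
  have h2 : 0 < ‖w - (inner ℝ u w / ‖u‖ ^ 2) • u‖ ^ 2 := by
    have := norm_pos_iff.2 hw
    positivity
  rw [norm_sub_sq_real, norm_smul, inner_smul_right, mul_pow, norm_eq_abs, sq_abs,
    real_inner_comm] at h2
  have h3 : 0 < ‖u‖ ^ 2 * ‖w‖ ^ 2 - inner ℝ u w ^ 2 := by
    have := mul_pos (pow_pos hu 2) h2
    rw [real_inner_comm]
    field_simp at this
    linarith
  rw [inner_add_right, norm_add_sq_real, real_inner_self_eq_norm_sq]
  linarith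

lemma tsum_span_eq (hu : u 2 = 0) (hw : w 2 = 0) (h : LinearIndependent ℝ ![u, w]) {a : ℝ}
    (ha : a ≠ 0) (F : ℝ → ℝ) :
    ∑' v : (Submodule.span ℤ ({u, w, (1 / 2 : ℝ) • (u + w) + a • EuclideanSpace.single 2 1} :
      Set (EuclideanSpace ℝ (Fin 3)))), F (‖(v : EuclideanSpace ℝ (Fin 3))‖ ^ 2) =
      ∑' v, F (latticeForm (‖u‖ ^ 2) (inner ℝ u (u + w)) (‖u + w‖ ^ 2) a v) := by
  have hu0 : 0 < ‖u‖ ^ 2 := by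
    have := norm_pos_iff.2 (h.ne_zero 0 : u ≠ 0)
    positivity
  obtain ⟨k, hk⟩ : ∃ k, k = (1 / 2 : ℝ) • (u + w) + a • EuclideanSpace.single (2 : Fin 3) (1 : ℝ) :=
    ⟨_, rfl⟩
  have hnorm := norm_sq_eq_latticeForm hu hw a
  rw [← hk] at hnorm ⊢
  have hmem (v : ℤ × ℤ × ℤ) : v.1 • u + v.2.1 • (u + w) + v.2.2 • k ∈
      Submodule.span ℤ ({u, w, k} : Set (EuclideanSpace ℝ (Fin 3))) :=
    Submodule.mem_span_triple.2 ⟨v.1 + v.2.1, v.2.1, v.2.2, by module⟩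
  let φ : ℤ × ℤ × ℤ → Submodule.span ℤ ({u, w, k} : Set (EuclideanSpace ℝ (Fin 3))) :=
    fun v => ⟨_, hmem v⟩
  have hφ : Function.Bijective φ := by
    constructor
    · intro v v' hvv
      have h1 : v.1 • u + v.2.1 • (u + w) + v.2.2 • k =
        v'.1 • u + v'.2.1 • (u + w) + v'.2.2 • k := congrArg Subtype.val hvv
      have h2 := hnorm (v.1 - v'.1) (v.2.1 - v'.2.1) (v.2.2 - v'.2.2)
      have h3 : (v.1 - v'.1) • u + (v.2.1 - v'.2.1) • (u + w) + (v.2.2 - v'.2.2) • k = 0 := by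
        rw [← sub_eq_zero.2 h1]
        module
      rw [h3, norm_zero, zero_pow two_ne_zero] at h2
      have h4 := (latticeForm_eq_zero_iff hu0 (inner_sq_lt h) ha).1 h2.symm
      exact sub_eq_zero.1 h4
    · rintro ⟨v, hv⟩
      obtain ⟨x, y, z, rfl⟩ := Submodule.mem_span_triple.1 hv
      exact ⟨(x - y, y, z), Subtype.ext (by simp only [φ]; module)⟩
  rw [← Equiv.tsum_eq (Equiv.ofBijective φ hφ)]
  refine tsum_congr fun v => ?_
  rw [← hnorm]
  rfl

/-- The odd vectors split into the two families of half-integral vectors of the plane lattice. -/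
def oddSplit : (ℤ × ℤ) ⊕ (ℤ × ℤ) ≃ ℤ × ℤ where
  toFun := Sum.elim (fun v => (v.1 - v.2, 2 * v.2)) fun v => (v.1 - v.2 - 1, 2 * v.2 + 1)
  invFun v := if v.2 % 2 = 0 then .inl (v.1 + v.2 / 2, v.2 / 2) else
    .inr (v.1 + v.2 / 2 + 1, v.2 / 2)
  left_inv := by
    rintro (⟨x, y⟩ | ⟨x, y⟩)
    · simp
    · have h1 : (2 * y + 1) % 2 = 1 := by omega
      have h2 : (2 * y + 1) / 2 = y := by omega
      simp only [Sum.elim_inr, h1, h2]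
      norm_num
      ring
  right_inv := by
    rintro ⟨x, y⟩
    by_cases h : y % 2 = 0
    · simp only [h, if_true, Sum.elim_inl, Prod.mk.injEq]
      omega
    · simp only [h, if_false, Sum.elim_inr, Prod.mk.injEq]
      omega

lemma tsum_half_add_tsum_half (h : LinearIndependent ℝ ![u, w]) {r : ℝ} (hr : 0 < r) :
    ∑' p : ℤ × ℤ, exp (-‖((p.1 : ℝ) + 1 / 2) • u + (p.2 : ℝ) • w‖ ^ 2 / r) +
      ∑' p : ℤ × ℤ, exp (-‖(p.1 : ℝ) • u + ((p.2 : ℝ) + 1 / 2) • w‖ ^ 2 / r) =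
    ∑' v, exp (-(oddForm (‖u‖ ^ 2) (inner ℝ u (u + w)) (‖u + w‖ ^ 2) v / 4) / r) := by
  have hu0 : 0 < ‖u‖ ^ 2 := by
    have := norm_pos_iff.2 (h.ne_zero 0 : u ≠ 0)
    positivity
  have hs : Summable fun v =>
      exp (-(oddForm (‖u‖ ^ 2) (inner ℝ u (u + w)) (‖u + w‖ ^ 2) v / 4) / r) := by
    refine (summable_exp_neg_oddForm hu0 (inner_sq_lt h) (r := 1 / (4 * r)) (by positivity)).congr
      fun v => ?_
    congr 1
    field_simp
  have hs' := oddSplit.summable_iff.2 hs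
  refine Eq.trans ?_ (((hs'.comp_injective Sum.inl_injective).tsum_sum
    (hs'.comp_injective Sum.inr_injective)).symm.trans (oddSplit.tsum_eq fun v =>
      exp (-(oddForm (‖u‖ ^ 2) (inner ℝ u (u + w)) (‖u + w‖ ^ 2) v / 4) / r)))
  congr 1 <;> refine tsum_congr fun v => ?_ <;>
    simp only [oddSplit, Equiv.coe_fn_mk, Function.comp_apply]
  · rw [Sum.elim_inl, ← norm_sq_eq_oddForm, show
      ((v.1 - v.2 : ℤ) + 1 / 2 + (2 * v.2 : ℤ) / 2 : ℝ) = v.1 + 1 / 2 by push_cast; ring,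
      show ((2 * v.2 : ℤ) / 2 : ℝ) = v.2 by push_cast; ring]
  · rw [Sum.elim_inr, ← norm_sq_eq_oddForm, show
      ((v.1 - v.2 - 1 : ℤ) + 1 / 2 + (2 * v.2 + 1 : ℤ) / 2 : ℝ) = v.1 by push_cast; ring,
      show ((2 * v.2 + 1 : ℤ) / 2 : ℝ) = v.2 + 1 / 2 by push_cast; ring]

lemma N2trace_eq_gramTrace (hu : u 2 = 0) (hw : w 2 = 0) (h : LinearIndependent ℝ ![u, w])
    {a t : ℝ} (ha : a ≠ 0) (ht : 0 < t) :
    N2trace u w a t = gramTrace (‖u‖ ^ 2) (inner ℝ u (u + w)) (‖u + w‖ ^ 2) a t := by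
  rw [N2trace, add_assoc, ← mul_add, tsum_half_add_tsum_half h (by positivity),
    tsum_span_eq hu hw h ha fun r => exp (-r / (4 * t)), covolume_eq_sqrt hu hw, gramTrace]

end TraceOfBasis

section Reduction

variable {v₁ v₂ u k : EuclideanSpace ℝ (Fin 3)} {h : ℝ}

/-- `u, k` is a basis of the plane lattice of `v₁, v₂` for which `k / 2` represents the class of
`(v₁ + v₂) / 2`. -/
structure IsAdapted (v₁ v₂ : EuclideanSpace ℝ (Fin 3)) (h : ℝ)
    (u k : EuclideanSpace ℝ (Fin 3)) : Prop where
  span_eq : Submodule.span ℤ {u, k} = Submodule.span ℤ {v₁, v₂}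
  half_sub_mem : (1 / 2 : ℝ) • k - (1 / 2 : ℝ) • (v₁ + v₂) ∈ Submodule.span ℤ {v₁, v₂}
  inner_sq_lt : inner ℝ u k ^ 2 < ‖u‖ ^ 2 * ‖k‖ ^ 2
  trace_eq : ∀ t > 0, N2trace v₁ v₂ h t = gramTrace (‖u‖ ^ 2) (inner ℝ u k) (‖k‖ ^ 2) h t

lemma span_pair_eq_span_pair {M : Type*} [AddCommGroup M] {u k u' k' : M}
    (hu : u ∈ Submodule.span ℤ {u', k'}) (hk : k ∈ Submodule.span ℤ {u', k'})
    (hu' : u' ∈ Submodule.span ℤ {u, k}) (hk' : k' ∈ Submodule.span ℤ {u, k}) :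
    Submodule.span ℤ {u, k} = Submodule.span ℤ {u', k'} :=
  le_antisymm (Submodule.span_le.2 (Set.pair_subset hu hk))
    (Submodule.span_le.2 (Set.pair_subset hu' hk'))

namespace IsAdapted

lemma initial (hv₁ : v₁ 2 = 0) (hv₂ : v₂ 2 = 0) (hind : LinearIndependent ℝ ![v₁, v₂])
    (hh : h ≠ 0) : IsAdapted v₁ v₂ h v₁ (v₁ + v₂) where
  span_eq := span_pair_eq_span_pair (Submodule.mem_span_pair.2 ⟨1, 0, by module⟩)
    (Submodule.mem_span_pair.2 ⟨1, 1, by module⟩) (Submodule.mem_span_pair.2 ⟨1, 0, by module⟩)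
    (Submodule.mem_span_pair.2 ⟨-1, 1, by module⟩)
  half_sub_mem := by simp
  inner_sq_lt := _root_.inner_sq_lt hind
  trace_eq _ ht := N2trace_eq_gramTrace hv₁ hv₂ hind hh ht

lemma mem_left (H : IsAdapted v₁ v₂ h u k) : u ∈ Submodule.span ℤ {v₁, v₂} :=
  H.span_eq ▸ Submodule.subset_span (by simp)

lemma mem_right (H : IsAdapted v₁ v₂ h u k) : k ∈ Submodule.span ℤ {v₁, v₂} :=
  H.span_eq ▸ Submodule.subset_span (by simp)

lemma norm_sq_pos (H : IsAdapted v₁ v₂ h u k) : 0 < ‖u‖ ^ 2 := by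
  refine lt_of_le_of_ne (sq_nonneg _) fun h0 => ?_
  have h1 := H.inner_sq_lt
  rw [← h0, zero_mul] at h1
  exact h1.not_ge (sq_nonneg _)

lemma shift (H : IsAdapted v₁ v₂ h u k) (j : ℤ) : IsAdapted v₁ v₂ h u (k + (2 * j) • u) := by
  have e1 : inner ℝ u (k + (2 * j) • u) = inner ℝ u k + 2 * j * ‖u‖ ^ 2 := by
    rw [← Int.cast_smul_eq_zsmul ℝ, inner_add_right, inner_smul_right, real_inner_self_eq_norm_sq]
    push_cast
    ring
  have e2 : ‖k + (2 * j) • u‖ ^ 2 = ‖k‖ ^ 2 + 4 * j * inner ℝ u k + 4 * j ^ 2 * ‖u‖ ^ 2 := by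
    rw [← Int.cast_smul_eq_zsmul ℝ, norm_add_sq_real, inner_smul_right, norm_smul,
      real_inner_comm, mul_pow, norm_eq_abs, sq_abs]
    push_cast
    ring
  refine ⟨?_, ?_, ?_, fun t ht => ?_⟩
  · rw [← H.span_eq]
    exact span_pair_eq_span_pair (Submodule.mem_span_pair.2 ⟨1, 0, by module⟩)
      (Submodule.mem_span_pair.2 ⟨2 * j, 1, by module⟩)
      (Submodule.mem_span_pair.2 ⟨1, 0, by module⟩)
      (Submodule.mem_span_pair.2 ⟨-(2 * j), 1, by module⟩)
  · have := add_mem H.half_sub_mem (Submodule.smul_mem _ j H.mem_left)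
    convert this using 1
    module
  · rw [e1, e2]
    linarith [H.inner_sq_lt]
  · rw [e1, e2, gramTrace_shift, H.trace_eq t ht]

lemma sub (H : IsAdapted v₁ v₂ h u k) : IsAdapted v₁ v₂ h (u - k) k := by
  have e1 : inner ℝ (u - k) k = inner ℝ u k - ‖k‖ ^ 2 := by
    rw [inner_sub_left, real_inner_self_eq_norm_sq]
  refine ⟨?_, H.half_sub_mem, ?_, fun t ht => ?_⟩
  · rw [← H.span_eq]
    exact span_pair_eq_span_pair (Submodule.mem_span_pair.2 ⟨1, -1, by module⟩)
      (Submodule.mem_span_pair.2 ⟨0, 1, by module⟩)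
      (Submodule.mem_span_pair.2 ⟨1, 1, by module⟩)
      (Submodule.mem_span_pair.2 ⟨0, 1, by module⟩)
  · rw [e1, norm_sub_sq_real]
    linarith [H.inner_sq_lt]
  · rw [e1, norm_sub_sq_real, gramTrace_sub, H.trace_eq t ht]

lemma neg (H : IsAdapted v₁ v₂ h u k) : IsAdapted v₁ v₂ h u (-k) := by
  refine ⟨?_, ?_, ?_, fun t ht => ?_⟩
  · rw [← H.span_eq]
    exact span_pair_eq_span_pair (Submodule.mem_span_pair.2 ⟨1, 0, by module⟩)
      (Submodule.mem_span_pair.2 ⟨0, -1, by module⟩)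
      (Submodule.mem_span_pair.2 ⟨1, 0, by module⟩)
      (Submodule.mem_span_pair.2 ⟨0, -1, by module⟩)
  · have := sub_mem H.half_sub_mem H.mem_right
    convert this using 1
    module
  · rw [inner_neg_right, neg_sq, norm_neg]
    exact H.inner_sq_lt
  · rw [inner_neg_right, norm_neg, gramTrace_neg, H.trace_eq t ht]

lemma exists_norm_sq_minimal (hv₁ : v₁ 2 = 0) (hv₂ : v₂ 2 = 0)
    (hind : LinearIndependent ℝ ![v₁, v₂]) (hh : h ≠ 0) :
    ∃ u k, IsAdapted v₁ v₂ h u k ∧ ∀ u' k', IsAdapted v₁ v₂ h u' k' → ‖u‖ ^ 2 ≤ ‖u'‖ ^ 2 := by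
  have H := initial hv₁ hv₂ hind hh
  obtain ⟨C, hC⟩ : ∃ C, C = ‖v₁‖ ^ 2 := ⟨_, rfl⟩
  have hfin : {v : EuclideanSpace ℝ (Fin 3) |
      v ∈ Submodule.span ℤ {v₁, v₂} ∧ ‖v‖ ^ 2 ≤ C}.Finite := by
    have h1 := summable_exp_neg_latticeForm H.norm_sq_pos H.inner_sq_lt hh one_pos
    simp only [one_mul] at h1
    refine ((finite_sublevel_of_summable_exp h1 C).image fun v : ℤ × ℤ × ℤ => v.1 • v₁ +
      v.2.1 • (v₁ + v₂) + v.2.2 • ((1 / 2 : ℝ) • (v₁ + v₂) + h • EuclideanSpace.single 2 1)).subset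
      ?_
    rintro v ⟨hv, hvC⟩
    obtain ⟨x, y, rfl⟩ := Submodule.mem_span_pair.1 hv
    have e : x • v₁ + y • v₂ = (x - y) • v₁ + y • (v₁ + v₂) +
        (0 : ℤ) • ((1 / 2 : ℝ) • (v₁ + v₂) + h • EuclideanSpace.single 2 1) := by module
    refine ⟨(x - y, y, 0), ?_, e.symm⟩
    change latticeForm _ _ _ h (x - y, y, 0) ≤ C
    rw [← norm_sq_eq_latticeForm hv₁ hv₂, ← e]
    exact hvC
  have hfin' : {v | (∃ k, IsAdapted v₁ v₂ h v k) ∧ ‖v‖ ^ 2 ≤ C}.Finite :=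
    hfin.subset fun v hv => ⟨hv.1.choose_spec.mem_left, hv.2⟩
  obtain ⟨u, ⟨⟨k, hk⟩, hu⟩, hmin⟩ := Set.exists_min_image _ (fun v => ‖v‖ ^ 2) hfin'
    ⟨v₁, ⟨_, H⟩, hC.ge⟩
  refine ⟨u, k, hk, fun u' k' H' => ?_⟩
  by_cases hu' : ‖u'‖ ^ 2 ≤ C
  · exact hmin u' ⟨⟨k', H'⟩, hu'⟩
  · exact hu.trans (not_le.1 hu').le

lemma exists_isReducedGram (hv₁ : v₁ 2 = 0) (hv₂ : v₂ 2 = 0)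
    (hind : LinearIndependent ℝ ![v₁, v₂]) (hh : h ≠ 0) :
    ∃ u k, IsAdapted v₁ v₂ h u k ∧ IsReducedGram (‖u‖ ^ 2) (inner ℝ u k) (‖k‖ ^ 2) := by
  obtain ⟨u, k₀, H₀, hmin⟩ := exists_norm_sq_minimal hv₁ hv₂ hind hh
  have hu := H₀.norm_sq_pos
  obtain ⟨k₁, H₁, hk₁⟩ : ∃ k, IsAdapted v₁ v₂ h u k ∧ |inner ℝ u k| ≤ ‖u‖ ^ 2 := by
    refine ⟨_, H₀.shift (-round (inner ℝ u k₀ / (2 * ‖u‖ ^ 2))), ?_⟩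
    have h1 := abs_sub_round (inner ℝ u k₀ / (2 * ‖u‖ ^ 2))
    rw [← Int.cast_smul_eq_zsmul ℝ, inner_add_right, inner_smul_right, real_inner_self_eq_norm_sq]
    push_cast
    have e : inner ℝ u k₀ = inner ℝ u k₀ / (2 * ‖u‖ ^ 2) * (2 * ‖u‖ ^ 2) :=
      (div_mul_cancel₀ _ (mul_pos two_pos hu).ne').symm
    generalize inner ℝ u k₀ / (2 * ‖u‖ ^ 2) = r at *
    rw [e, show r * (2 * ‖u‖ ^ 2) + 2 * -(round r : ℝ) * ‖u‖ ^ 2 =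
      (r - round r) * (2 * ‖u‖ ^ 2) by ring, abs_mul, abs_of_pos (show 0 < 2 * ‖u‖ ^ 2 by linarith)]
    nlinarith
  obtain ⟨k, H, hk⟩ : ∃ k, IsAdapted v₁ v₂ h u k ∧ 0 ≤ inner ℝ u k ∧ inner ℝ u k ≤ ‖u‖ ^ 2 := by
    rcases le_total 0 (inner ℝ u k₁) with h0 | h0
    · exact ⟨k₁, H₁, h0, (le_abs_self _).trans hk₁⟩
    · refine ⟨-k₁, H₁.neg, ?_⟩
      rw [inner_neg_right]
      exact ⟨neg_nonneg.2 h0, (neg_le_abs _).trans hk₁⟩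
  refine ⟨u, k, H, hu, hk.1, hk.2, ?_, H.inner_sq_lt⟩
  have := hmin _ _ H.sub
  rw [norm_sub_sq_real] at this
  linarith

end IsAdapted

end Reduction

section Isometry

lemma planeProj_add (v w : EuclideanSpace ℝ (Fin 3)) :
    planeProj (v + w) = planeProj v + planeProj w := by
  ext i
  fin_cases i <;> simp [planeProj]

lemma planeProj_smul (r : ℝ) (v : EuclideanSpace ℝ (Fin 3)) :
    planeProj (r • v) = r • planeProj v := by
  ext i
  fin_cases i <;> simp [planeProj]

lemma planeProj_zsmul (n : ℤ) (v : EuclideanSpace ℝ (Fin 3)) :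
    planeProj (n • v) = n • planeProj v := by
  rw [← Int.cast_smul_eq_zsmul ℝ, planeProj_smul, Int.cast_smul_eq_zsmul]

lemma inner_planeProj {v : EuclideanSpace ℝ (Fin 3)} (hv : v 2 = 0)
    (w : EuclideanSpace ℝ (Fin 3)) : inner ℝ (planeProj v) (planeProj w) = inner ℝ v w := by
  simp [planeProj, PiLp.inner_apply, Fin.sum_univ_succ, hv]

lemma norm_planeProj {v : EuclideanSpace ℝ (Fin 3)} (hv : v 2 = 0) :
    ‖planeProj v‖ = ‖v‖ := by
  rw [norm_eq_sqrt_real_inner, inner_planeProj hv, ← norm_eq_sqrt_real_inner]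

lemma apply_two_eq_zero_of_mem_span {v₁ v₂ v : EuclideanSpace ℝ (Fin 3)} (hv₁ : v₁ 2 = 0)
    (hv₂ : v₂ 2 = 0) (hv : v ∈ Submodule.span ℤ {v₁, v₂}) : v 2 = 0 := by
  obtain ⟨x, y, rfl⟩ := Submodule.mem_span_pair.1 hv
  simp [hv₁, hv₂]

lemma linearIndependent_pair_of_inner_sq_lt {E : Type*} [NormedAddCommGroup E]
    [InnerProductSpace ℝ E] {a b : E} (hD : inner ℝ a b ^ 2 < ‖a‖ ^ 2 * ‖b‖ ^ 2) :
    LinearIndependent ℝ ![a, b] := by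
  rw [LinearIndependent.pair_iff]
  intro x y hxy
  have h1 : x * ‖a‖ ^ 2 + y * inner ℝ a b = 0 := by
    simpa [inner_add_right, inner_smul_right] using congrArg (inner ℝ a) hxy
  have h2 : x * inner ℝ a b + y * ‖b‖ ^ 2 = 0 := by
    simpa [inner_add_right, inner_smul_right, real_inner_comm] using congrArg (inner ℝ b) hxy
  have hD' := (sub_pos.2 hD).ne'
  exact ⟨(mul_eq_zero_iff_right hD').1 (by linear_combination ‖b‖ ^ 2 * h1 - inner ℝ a b * h2),
    (mul_eq_zero_iff_right hD').1 (by linear_combination ‖a‖ ^ 2 * h2 - inner ℝ a b * h1)⟩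

lemma exists_linearIsometryEquiv_apply_eq {E F : Type*} [NormedAddCommGroup E]
    [InnerProductSpace ℝ E] [NormedAddCommGroup F] [InnerProductSpace ℝ F]
    (hE : Module.finrank ℝ E = 2) (hF : Module.finrank ℝ F = 2) {a b : E} {a' b' : F}
    (hD : inner ℝ a b ^ 2 < ‖a‖ ^ 2 * ‖b‖ ^ 2) (ha : ‖a‖ ^ 2 = ‖a'‖ ^ 2)
    (hab : inner ℝ a b = inner ℝ a' b') (hb : ‖b‖ ^ 2 = ‖b'‖ ^ 2) :
    ∃ O : E ≃ₗᵢ[ℝ] F, O a = a' ∧ O b = b' := by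
  have hD' := hD
  rw [ha, hab, hb] at hD'
  let B := basisOfLinearIndependentOfCardEqFinrank (linearIndependent_pair_of_inner_sq_lt hD)
    (by simp [hE])
  let B' := basisOfLinearIndependentOfCardEqFinrank (linearIndependent_pair_of_inner_sq_lt hD')
    (by simp [hF])
  let e := B.equiv B' (Equiv.refl _)
  have hea : e a = a' := by simpa [B, B'] using B.equiv_apply 0 B' (Equiv.refl _)
  have heb : e b = b' := by simpa [B, B'] using B.equiv_apply 1 B' (Equiv.refl _)
  refine ⟨⟨e, fun x => ?_⟩, hea, heb⟩
  obtain ⟨r, t, rfl⟩ : ∃ r t : ℝ, x = r • a + t • b :=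
    ⟨B.repr x 0, B.repr x 1, by simpa [B, Fin.sum_univ_two] using (B.sum_repr x).symm⟩
  rw [map_add, map_smul, map_smul, hea, heb, ← sq_eq_sq₀ (norm_nonneg _) (norm_nonneg _),
    norm_add_sq_real, norm_add_sq_real]
  simp only [inner_smul_left, inner_smul_right, norm_smul, mul_pow, ha, hab, hb]

lemma IsAdapted.exists_linearIsometryEquiv {v₁ v₂ v₁' v₂' u k u' k' : EuclideanSpace ℝ (Fin 3)}
    {h h' : ℝ} (hp1 : v₁ 2 = 0) (hp2 : v₂ 2 = 0) (hp1' : v₁' 2 = 0) (hp2' : v₂' 2 = 0)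
    (H : IsAdapted v₁ v₂ h u k) (H' : IsAdapted v₁' v₂' h' u' k')
    (hu : ‖u‖ ^ 2 = ‖u'‖ ^ 2) (huk : inner ℝ u k = inner ℝ u' k') (hk : ‖k‖ ^ 2 = ‖k'‖ ^ 2) :
    ∃ O : EuclideanSpace ℝ (Fin 2) ≃ₗᵢ[ℝ] EuclideanSpace ℝ (Fin 2),
      O '' (planeProj ''
          (Submodule.span ℤ ({v₁, v₂} : Set (EuclideanSpace ℝ (Fin 3))) :
            Set (EuclideanSpace ℝ (Fin 3)))) =
        planeProj ''
          (Submodule.span ℤ ({v₁', v₂'} : Set (EuclideanSpace ℝ (Fin 3))) :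
            Set (EuclideanSpace ℝ (Fin 3))) ∧
      ∃ u ∈ Submodule.span ℤ ({v₁', v₂'} : Set (EuclideanSpace ℝ (Fin 3))),
        O (planeProj ((1/2 : ℝ) • (v₁ + v₂))) =
          planeProj ((1/2 : ℝ) • (v₁' + v₂') + u) := by
  have cu := apply_two_eq_zero_of_mem_span hp1 hp2 H.mem_left
  have ck := apply_two_eq_zero_of_mem_span hp1 hp2 H.mem_right
  have cu' := apply_two_eq_zero_of_mem_span hp1' hp2' H'.mem_left
  have ck' := apply_two_eq_zero_of_mem_span hp1' hp2' H'.mem_right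
  obtain ⟨O, hOu, hOk⟩ := exists_linearIsometryEquiv_apply_eq finrank_euclideanSpace_fin
    finrank_euclideanSpace_fin (a := planeProj u) (b := planeProj k) (a' := planeProj u')
    (b' := planeProj k')
    (by rw [inner_planeProj cu, norm_planeProj cu, norm_planeProj ck]; exact H.inner_sq_lt)
    (by rw [norm_planeProj cu, norm_planeProj cu', hu])
    (by rw [inner_planeProj cu, inner_planeProj cu', huk])
    (by rw [norm_planeProj ck, norm_planeProj ck', hk])
  have hO (m n : ℤ) : O (planeProj (m • u + n • k)) = planeProj (m • u' + n • k') := by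
    simp only [planeProj_add, planeProj_zsmul, map_add, map_zsmul, hOu, hOk]
  refine ⟨O, ?_, ?_⟩
  · rw [← H.span_eq, ← H'.span_eq]
    ext x
    simp only [Set.mem_image, SetLike.mem_coe, Submodule.mem_span_pair]
    constructor
    · rintro ⟨_, ⟨_, ⟨m, n, rfl⟩, rfl⟩, rfl⟩
      exact ⟨_, ⟨m, n, rfl⟩, (hO m n).symm⟩
    · rintro ⟨_, ⟨m, n, rfl⟩, rfl⟩
      exact ⟨_, ⟨_, ⟨m, n, rfl⟩, rfl⟩, hO m n⟩
  · have hw := H.half_sub_mem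
    rw [← H.span_eq] at hw
    obtain ⟨m, n, hw⟩ := Submodule.mem_span_pair.1 hw
    have hw' : m • u' + n • k' ∈ Submodule.span ℤ {v₁', v₂'} :=
      H'.span_eq ▸ Submodule.mem_span_pair.2 ⟨m, n, rfl⟩
    refine ⟨_, sub_mem H'.half_sub_mem hw', ?_⟩
    rw [show (1 / 2 : ℝ) • (v₁ + v₂) = (1 / 2 : ℝ) • k + ((-m) • u + (-n) • k) by
      rw [show (-m) • u + (-n) • k = -(m • u + n • k) by module, hw]; module,
      planeProj_add, map_add, hO, planeProj_smul, map_smul, hOk, ← planeProj_smul,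
      ← planeProj_add]
    congr 1
    module

end Isometry

/-- Case `N₂` of Theorem B: two flat 3-manifolds of type `N₂` with equal trace functions are
isometric: they have the same height `h`, and there is a linear isometry of `ℝ²` carrying one
plane lattice onto the other and matching the half-sum points modulo the lattice. -/
theorem N2_isospectral_implies_isometric
    (v₁ v₂ v₁' v₂' : EuclideanSpace ℝ (Fin 3)) (h h' : ℝ)
    (hp1 : v₁ 2 = 0) (hp2 : v₂ 2 = 0) (hp1' : v₁' 2 = 0) (hp2' : v₂' 2 = 0)
    (hind : LinearIndependent ℝ ![v₁, v₂]) (hind' : LinearIndependent ℝ ![v₁', v₂'])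
    (hh : 0 < h) (hh' : 0 < h')
    (heq : ∀ t : ℝ, 0 < t → N2trace v₁ v₂ h t = N2trace v₁' v₂' h' t) :
    h = h' ∧ ∃ O : EuclideanSpace ℝ (Fin 2) ≃ₗᵢ[ℝ] EuclideanSpace ℝ (Fin 2),
      O '' (planeProj ''
          (Submodule.span ℤ ({v₁, v₂} : Set (EuclideanSpace ℝ (Fin 3))) :
            Set (EuclideanSpace ℝ (Fin 3)))) =
        planeProj ''
          (Submodule.span ℤ ({v₁', v₂'} : Set (EuclideanSpace ℝ (Fin 3))) :
            Set (EuclideanSpace ℝ (Fin 3))) ∧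
      ∃ u ∈ Submodule.span ℤ ({v₁', v₂'} : Set (EuclideanSpace ℝ (Fin 3))),
        O (planeProj ((1/2 : ℝ) • (v₁ + v₂))) =
          planeProj ((1/2 : ℝ) • (v₁' + v₂') + u) := by
  obtain ⟨u, k, H, hr⟩ := IsAdapted.exists_isReducedGram hp1 hp2 hind hh.ne'
  obtain ⟨u', k', H', hr'⟩ := IsAdapted.exists_isReducedGram hp1' hp2' hind' hh'.ne'
  obtain ⟨hvol, hO, hL⟩ := fiberCount_eq_of_gramTrace_eq hr.pos hr.sq_lt hh hr'.pos hr'.sq_lt hh'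
    fun t ht => by rw [← H.trace_eq t ht, ← H'.trace_eq t ht, heq t ht]
  obtain ⟨hu, huk, hk, rfl⟩ := hr.eq_of_isospectral hr' hh hh' hvol hO hL
  exact ⟨rfl, H.exists_linearIsometryEquiv hp1 hp2 hp1' hp2' H' hu huk hk⟩
end

section
/- For positive reals a₁, a₂, a₃ set Λ(a₁,a₂,a₃) = {(a₁m₁, a₂m₂, a₃m₃) : (m₁,m₂,m₃) ∈ ℤ³} and define, for t > 0, P_{a₁,a₂,a₃}(t) = ((a₁a₂a₃/4)/(4πt)^{3/2}) ∑_{v∈Λ(a₁,a₂,a₃)} e^{−‖v‖²/(4t)} + (a₁/(8√(πt))) ∑_{m∈ℤ} e^{−(m + 1/2)² a₁²/(4t)} + (a₁a₂/(16πt)) ∑_{(m,n)∈ℤ²} e^{−[a₁²m² + a₂²(n + 1/2)²]/(4t)} + (a₁a₃/(16πt)) ∑_{(m,k)∈ℤ²} e^{−[a₁²(m + 1/2)² + a₃²(k + 1/2)²]/(4t)}. If (a₁,a₂,a₃) and (b₁,b₂,b₃) are triples of positive reals with P_{a₁,a₂,a₃}(t) = P_{b₁,b₂,b₃}(t) for all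 t > 0, then a₁ = b₁, a₂ = b₂ and a₃ = b₃. -/
open Real

/-- The rectangular lattice `Λ(a₁,a₂,a₃) = {(a₁m₁, a₂m₂, a₃m₃) : (m₁,m₂,m₃) ∈ ℤ³} ⊂ ℝ³`. -/
def rectLattice (a₁ a₂ a₃ : ℝ) : Set (EuclideanSpace ℝ (Fin 3)) :=
  {v | ∃ m : ℤ × ℤ × ℤ,
    v = (WithLp.equiv 2 (Fin 3 → ℝ)).symm ![a₁ * m.1, a₂ * m.2.1, a₃ * m.2.2]}

/-- The trace function `tr(H_{N₄})` of the non-orientable flat 3-manifold `N₄` with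
right-angled covering torus lattice of side lengths `a₁, a₂, a₃` and
`vol(N₄) = a₁a₂a₃/4` (Theorem A). -/
noncomputable def N4trace (a₁ a₂ a₃ t : ℝ) : ℝ :=
  (a₁ * a₂ * a₃ / 4) / (4 * π * t) ^ ((3:ℝ)/2) *
    (∑' v : rectLattice a₁ a₂ a₃, Real.exp (-‖(v : EuclideanSpace ℝ (Fin 3))‖ ^ 2 / (4 * t))) +
  a₁ / (8 * Real.sqrt (π * t)) *
    (∑' m : ℤ, Real.exp (-((m : ℝ) + 1/2) ^ 2 * a₁ ^ 2 / (4 * t))) +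
  (a₁ * a₂) / (16 * π * t) *
    (∑' p : ℤ × ℤ,
      Real.exp (-(a₁ ^ 2 * (p.1 : ℝ) ^ 2 + a₂ ^ 2 * ((p.2 : ℝ) + 1/2) ^ 2) / (4 * t))) +
  (a₁ * a₃) / (16 * π * t) *
    (∑' p : ℤ × ℤ,
      Real.exp (-(a₁ ^ 2 * ((p.1 : ℝ) + 1/2) ^ 2 + a₃ ^ 2 * ((p.2 : ℝ) + 1/2) ^ 2) / (4 * t)))

open Filter Topology

/-- `f` is the sum of the Dirichlet series `∑ N(r) e^{-r x}`, whose exponents are locally finite. -/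
structure IsDirichletSeries (N f : ℝ → ℝ) : Prop where
  finite : ∀ R, {r | r ≤ R ∧ N r ≠ 0}.Finite
  hasSum : ∀ x, 0 < x → HasSum (fun r => N r * exp (-r * x)) (f x)

namespace IsDirichletSeries

variable {N M f g : ℝ → ℝ}

lemma add (hf : IsDirichletSeries N f) (hg : IsDirichletSeries M g) :
    IsDirichletSeries (fun r => N r + M r) (fun x => f x + g x) where
  finite R := by
    refine ((hf.finite R).union (hg.finite R)).subset ?_
    rintro r ⟨hr, h⟩
    by_cases hN : N r = 0
    · exact Or.inr ⟨hr, fun hM => h (by simp [hN, hM])⟩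
    · exact Or.inl ⟨hr, hN⟩
  hasSum x hx := by
    simpa only [add_mul] using (hf.hasSum x hx).add (hg.hasSum x hx)

lemma const_mul (c : ℝ) (hf : IsDirichletSeries N f) :
    IsDirichletSeries (fun r => c * N r) (fun x => c * f x) where
  finite R := (hf.finite R).subset fun _ ⟨hr, h⟩ => ⟨hr, right_ne_zero_of_mul h⟩
  hasSum x hx := by
    simpa only [mul_assoc] using (hf.hasSum x hx).mul_left c

lemma sub (hf : IsDirichletSeries N f) (hg : IsDirichletSeries M g) :
    IsDirichletSeries (fun r => N r - M r) (fun x => f x - g x) := by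
  simpa only [neg_one_mul, ← sub_eq_add_neg] using hf.add (hg.const_mul (-1))

lemma tendsto_mul_exp (hf : IsDirichletSeries N f) {r₀ : ℝ} (hmin : ∀ r < r₀, N r = 0) :
    Tendsto (fun x => f x * exp (r₀ * x)) atTop (𝓝 (N r₀)) := by
  have key : Tendsto (fun x => ∑' r, N r * exp (-(r - r₀) * x)) atTop
      (𝓝 (∑' r, if r = r₀ then N r₀ else 0)) := by
    refine tendsto_tsum_of_dominated_convergence
      (bound := fun r => |N r * exp (-r * 1)| * exp r₀) ?_ ?_ ?_
    · exact ((hf.hasSum 1 one_pos).summable.abs).mul_right _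
    · intro r
      rcases lt_trichotomy r r₀ with h | rfl | h
      · simp [hmin r h, h.ne]
      · simp
      · rw [if_neg h.ne']
        have : Tendsto (fun x : ℝ => exp (-(r - r₀) * x)) atTop (𝓝 0) :=
          tendsto_exp_atBot.comp (tendsto_id.const_mul_atTop_of_neg (by linarith))
        simpa using this.const_mul (N r)
    · filter_upwards [eventually_ge_atTop 1] with x hx r
      rcases lt_or_ge r r₀ with h | h
      · simp [hmin r h]
      · rw [norm_mul, abs_mul, Real.norm_eq_abs, Real.norm_eq_abs, abs_exp, abs_exp, mul_assoc,
          ← exp_add]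
        gcongr
        nlinarith
  rw [tsum_ite_eq] at key
  refine key.congr' ?_
  filter_upwards [eventually_gt_atTop 0] with x hx
  rw [← (hf.hasSum x hx).tsum_eq, ← tsum_mul_right]
  refine tsum_congr fun r => ?_
  rw [mul_assoc, ← exp_add]
  ring_nf

lemma exists_least (hf : IsDirichletSeries N f) (hN : N ≠ 0) :
    ∃ r₀, N r₀ ≠ 0 ∧ ∀ r < r₀, N r = 0 := by
  obtain ⟨R, hR⟩ := Function.ne_iff.1 hN
  obtain ⟨r₀, h₀, hmin⟩ := (hf.finite R).exists_minimalFor id _ ⟨R, le_rfl, hR⟩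
  refine ⟨r₀, h₀.2, fun r hr => ?_⟩
  by_contra hne
  exact absurd (hmin ⟨hr.le.trans h₀.1, hne⟩ hr.le) (not_le.2 hr)

lemma coeff_eq_zero (hf : IsDirichletSeries N f) (h0 : ∀ x, 0 < x → f x = 0) : N = 0 := by
  by_contra hN
  obtain ⟨r₀, hr₀, hmin⟩ := hf.exists_least hN
  refine hr₀ (tendsto_nhds_unique (hf.tendsto_mul_exp hmin) (tendsto_const_nhds.congr' ?_))
  filter_upwards [eventually_gt_atTop 0] with x hx
  simp [h0 x hx]

end IsDirichletSeries

/-- `f(s)` is asymptotic to a nonzero multiple of `s^k e^{-r s²}` for some `r`. -/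
def HasLeadingTerm (f : ℝ → ℝ) (k : ℕ) : Prop :=
  ∃ r S : ℝ, S ≠ 0 ∧ Tendsto (fun s => f s * exp (r * s ^ 2) / s ^ k) atTop (𝓝 S)

lemma HasLeadingTerm.exists_ne_zero {f : ℝ → ℝ} {k : ℕ} (hf : HasLeadingTerm f k) :
    ∃ s, 0 < s ∧ f s ≠ 0 := by
  obtain ⟨r, S, hS, h⟩ := hf
  by_contra! h0
  refine hS (tendsto_nhds_unique h (tendsto_const_nhds.congr' ?_))
  filter_upwards [eventually_gt_atTop 0] with s hs
  simp [h0 s hs]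

lemma tendsto_pow_div_pow_mul_exp_neg_mul_sq {k l : ℕ} {d : ℝ} (hd : 0 < d ∨ d = 0 ∧ l < k) :
    Tendsto (fun s : ℝ => s ^ l / s ^ k * exp (-d * s ^ 2)) atTop (𝓝 0) := by
  rcases hd with hd | ⟨rfl, hlk⟩
  · have h1 : Tendsto (fun s : ℝ => d * s ^ 2) atTop atTop :=
      (tendsto_pow_atTop two_ne_zero).const_mul_atTop hd
    have h2 := ((tendsto_pow_mul_exp_neg_atTop_nhds_zero l).comp h1).const_mul (1 / d ^ l)
    rw [mul_zero] at h2
    refine squeeze_zero' ?_ ?_ h2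
    · filter_upwards [eventually_gt_atTop 0] with s hs
      positivity
    · filter_upwards [eventually_ge_atTop 1] with s hs
      simp only [Function.comp, ← mul_assoc, neg_mul]
      gcongr
      rw [mul_pow, one_div, inv_mul_cancel_left₀ (by positivity), ← pow_mul]
      exact (div_le_self (by positivity) (one_le_pow₀ hs)).trans
        (pow_le_pow_right₀ hs (by lia))
  · simpa using tendsto_pow_div_pow_atTop_zero hlk

lemma HasLeadingTerm.add {f g : ℝ → ℝ} {k l : ℕ} (hf : HasLeadingTerm f k)
    (hg : HasLeadingTerm g l) (hkl : k ≠ l) :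
    HasLeadingTerm (fun s => f s + g s) k ∨ HasLeadingTerm (fun s => f s + g s) l := by
  have dominated : ∀ {f g : ℝ → ℝ} {k l : ℕ} {r S q T : ℝ}, S ≠ 0 →
      Tendsto (fun s => f s * exp (r * s ^ 2) / s ^ k) atTop (𝓝 S) →
      Tendsto (fun s => g s * exp (q * s ^ 2) / s ^ l) atTop (𝓝 T) →
      (0 < q - r ∨ q - r = 0 ∧ l < k) → HasLeadingTerm (fun s => f s + g s) k := by
    intro f g k l r S q T hS hf hg hd
    refine ⟨r, S, hS, ?_⟩
    have := hf.add (hg.mul (tendsto_pow_div_pow_mul_exp_neg_mul_sq hd))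
    rw [mul_zero, add_zero] at this
    refine this.congr' ?_
    filter_upwards [eventually_gt_atTop 0] with s hs
    have : exp (r * s ^ 2) = exp (q * s ^ 2) * exp (-(q - r) * s ^ 2) := by
      rw [← exp_add]; ring_nf
    rw [this]
    field_simp
  obtain ⟨r, S, hS, hf⟩ := hf
  obtain ⟨q, T, hT, hg⟩ := hg
  by_cases h : 0 < q - r ∨ q - r = 0 ∧ l < k
  · exact Or.inl (dominated hS hf hg h)
  · refine Or.inr ?_
    simp_rw [add_comm (f _)]
    refine dominated hT hg hf ?_
    by_contra h'
    grind

/-- Either `f` vanishes on the positive half-line, or its leading term has exponent in `K`. -/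
def VanishesOrLeads (f : ℝ → ℝ) (K : Set ℕ) : Prop :=
  (∀ s, 0 < s → f s = 0) ∨ ∃ k ∈ K, HasLeadingTerm f k

namespace VanishesOrLeads

variable {f g : ℝ → ℝ} {K L : Set ℕ}

lemma hasLeadingTerm_add_or (hf : VanishesOrLeads f K) (hg : VanishesOrLeads g L)
    (hKL : Disjoint K L) :
    ((∀ s, 0 < s → f s = 0) ∧ ∀ s, 0 < s → g s = 0) ∨
      ∃ k ∈ K ∪ L, HasLeadingTerm (fun s => f s + g s) k := by
  have congr : ∀ {u v : ℝ → ℝ} {k : ℕ}, HasLeadingTerm u k → (∀ s, 0 < s → v s = u s) →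
      HasLeadingTerm v k := by
    rintro u v k ⟨r, S, hS, h⟩ huv
    refine ⟨r, S, hS, h.congr' ?_⟩
    filter_upwards [eventually_gt_atTop 0] with s hs
    rw [huv s hs]
  rcases hf with hf | ⟨k, hk, hf⟩ <;> rcases hg with hg | ⟨l, hl, hg⟩
  · exact Or.inl ⟨hf, hg⟩
  · exact Or.inr ⟨l, Or.inr hl, congr hg fun s hs => by simp [hf s hs]⟩
  · exact Or.inr ⟨k, Or.inl hk, congr hf fun s hs => by simp [hg s hs]⟩
  · rcases hf.add hg (fun h => Set.disjoint_left.1 hKL hk (h ▸ hl)) with h | h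
    · exact Or.inr ⟨k, Or.inl hk, h⟩
    · exact Or.inr ⟨l, Or.inr hl, h⟩

lemma add (hf : VanishesOrLeads f K) (hg : VanishesOrLeads g L) (hKL : Disjoint K L) :
    VanishesOrLeads (fun s => f s + g s) (K ∪ L) := by
  rcases hf.hasLeadingTerm_add_or hg hKL with ⟨h, h'⟩ | h
  · exact Or.inl fun s hs => by simp [h s hs, h' s hs]
  · exact Or.inr h

lemma eq_zero_of_add_eq_zero (hf : VanishesOrLeads f K) (hg : VanishesOrLeads g L)
    (hKL : Disjoint K L) (h0 : ∀ s, 0 < s → f s + g s = 0) :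
    (∀ s, 0 < s → f s = 0) ∧ ∀ s, 0 < s → g s = 0 := by
  rcases hf.hasLeadingTerm_add_or hg hKL with h | ⟨k, _, h⟩
  · exact h
  · obtain ⟨s, hs, hne⟩ := h.exists_ne_zero
    exact absurd (h0 s hs) hne

end VanishesOrLeads

lemma IsDirichletSeries.vanishesOrLeads {N f : ℝ → ℝ} (hf : IsDirichletSeries N f) (k : ℕ) :
    VanishesOrLeads (fun s => s ^ k * f (s ^ 2)) {k} := by
  by_cases hN : N = 0
  · refine Or.inl fun s hs => ?_
    have := hf.hasSum (s ^ 2) (by positivity)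
    simp only [hN, Pi.zero_apply, zero_mul] at this
    simp [this.unique hasSum_zero]
  · obtain ⟨r, hr, hmin⟩ := hf.exists_least hN
    refine Or.inr ⟨k, rfl, r, N r, hr, ?_⟩
    refine ((hf.tendsto_mul_exp hmin).comp (tendsto_pow_atTop two_ne_zero)).congr' ?_
    filter_upwards [eventually_gt_atTop 0] with s hs
    simp only [Function.comp]
    field_simp

/-- Dirichlet series multiplied by distinct half-integral powers are linearly independent. -/
lemma IsDirichletSeries.eq_zero_of_pow_mul_add_eq_zero {N₁ N₂ N₃ f₁ f₂ f₃ : ℝ → ℝ}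
    (h₁ : IsDirichletSeries N₁ f₁) (h₂ : IsDirichletSeries N₂ f₂) (h₃ : IsDirichletSeries N₃ f₃)
    (h : ∀ s, 0 < s → s ^ 1 * f₁ (s ^ 2) + (s ^ 2 * f₂ (s ^ 2) + s ^ 3 * f₃ (s ^ 2)) = 0) :
    (∀ x, 0 < x → f₁ x = 0) ∧ (∀ x, 0 < x → f₂ x = 0) ∧ ∀ x, 0 < x → f₃ x = 0 := by
  have of_sq : ∀ {f : ℝ → ℝ} {k : ℕ}, (∀ s, 0 < s → s ^ k * f (s ^ 2) = 0) →
      ∀ x, 0 < x → f x = 0 := by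
    intro f k h x hx
    have hs := sqrt_pos.2 hx
    simpa [sq_sqrt hx.le, hs.ne'] using h _ hs
  have h23 : Disjoint ({2} : Set ℕ) {3} := by simp
  obtain ⟨z₁, z⟩ := (h₁.vanishesOrLeads 1).eq_zero_of_add_eq_zero
    ((h₂.vanishesOrLeads 2).add (h₃.vanishesOrLeads 3) h23) (by simp) h
  obtain ⟨z₂, z₃⟩ := (h₂.vanishesOrLeads 2).eq_zero_of_add_eq_zero (h₃.vanishesOrLeads 3) h23 z
  exact ⟨of_sq z₁, of_sq z₂, of_sq z₃⟩

/-- The exponential sum `∑ᵢ e^{-μᵢ x}`. -/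
noncomputable def expSum {ι : Type*} (μ : ι → ℝ) (x : ℝ) : ℝ := ∑' i, exp (-μ i * x)

/-- The exponential sum `∑ᵢ e^{-μᵢ x}` converges for every `x > 0`. -/
def ExpSummable {ι : Type*} (μ : ι → ℝ) : Prop := ∀ x, 0 < x → Summable fun i => exp (-μ i * x)

/-- The number of indices `i` with `μ i = r`. -/
noncomputable def fiberCard {ι : Type*} (μ : ι → ℝ) (r : ℝ) : ℝ := Nat.card (μ ⁻¹' {r})

namespace ExpSummable

variable {ι κ : Type*} {μ : ι → ℝ} {ν : κ → ℝ}

lemma finite_le (h : ExpSummable μ) (R : ℝ) : {i | μ i ≤ R}.Finite := by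
  have := (h 1 one_pos).tendsto_cofinite_zero.eventually_lt_const (exp_pos (-R))
  refine (eventually_cofinite.1 this).subset fun i (hi : μ i ≤ R) => ?_
  simpa using hi

lemma fiberCard_ne_zero_iff (h : ExpSummable μ) {r : ℝ} :
    fiberCard μ r ≠ 0 ↔ ∃ i, μ i = r := by
  have : Finite (μ ⁻¹' {r}) := (h.finite_le r).subset fun i (hi : μ i = r) => hi.le
  rw [fiberCard, Nat.cast_ne_zero, Nat.card_ne_zero]
  simp [this]

lemma isDirichletSeries (h : ExpSummable μ) :
    IsDirichletSeries (fiberCard μ) (expSum μ) where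
  finite R := by
    refine ((h.finite_le R).image μ).subset ?_
    rintro r ⟨hr, hne⟩
    obtain ⟨i, rfl⟩ := h.fiberCard_ne_zero_iff.1 hne
    exact ⟨i, hr, rfl⟩
  hasSum x hx := by
    have heq : (fun r => fiberCard μ r * exp (-r * x)) =
        fun r => ∑' i : μ ⁻¹' {r}, exp (-μ i * x) := by
      funext r
      have : ∀ i : μ ⁻¹' {r}, exp (-μ i * x) = exp (-r * x) := fun i => by rw [i.2]
      simp_rw [this, tsum_const, nsmul_eq_mul, fiberCard]
    rw [heq]
    exact (h x hx).hasSum.tsum_fiberwise μ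

lemma prod (hμ : ExpSummable μ) (hν : ExpSummable ν) :
    ExpSummable fun p : ι × κ => μ p.1 + ν p.2 := fun x hx => by
  simpa only [neg_add, add_mul, exp_add] using (hμ x hx).mul_of_nonneg (hν x hx)
    (fun _ => (exp_pos _).le) (fun _ => (exp_pos _).le)

lemma expSum_prod (hμ : ExpSummable μ) (hν : ExpSummable ν) {x : ℝ} (hx : 0 < x) :
    expSum (fun p : ι × κ => μ p.1 + ν p.2) x = expSum μ x * expSum ν x := by
  rw [expSum, expSum, expSum, tsum_mul_tsum_of_summable_norm (hμ x hx).norm (hν x hx).norm]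
  simp only [neg_add, add_mul, exp_add]

lemma expSum_pos [Nonempty ι] (h : ExpSummable μ) {x : ℝ} (hx : 0 < x) : 0 < expSum μ x :=
  (h x hx).tsum_pos (fun _ => (exp_pos _).le) (Classical.arbitrary ι) (exp_pos _)

end ExpSummable

/-- The squared lengths of the points of the shifted one-dimensional lattice `c(ℤ + h)`. -/
def sqRate (c h : ℝ) (m : ℤ) : ℝ := c ^ 2 * ((m : ℝ) + h) ^ 2

/-- The squared lengths of the points of `c(ℤ + h) × d(ℤ + k)`. -/
def pairRate (c h d k : ℝ) (p : ℤ × ℤ) : ℝ := sqRate c h p.1 + sqRate d k p.2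

/-- The squared lengths of the points of the lattice `Λ(a₁,a₂,a₃)`. -/
def latticeRate (a₁ a₂ a₃ : ℝ) (p : ℤ × ℤ × ℤ) : ℝ := sqRate a₁ 0 p.1 + pairRate a₂ 0 a₃ 0 p.2

lemma expSummable_sqRate {c : ℝ} (hc : 0 < c) (h : ℝ) : ExpSummable (sqRate c h) := fun x hx => by
  refine (HurwitzKernelBounds.summable_f_int 0 h (t := c ^ 2 * x / π) (by positivity)).congr ?_
  intro m
  rw [HurwitzKernelBounds.f_int, pow_zero, one_mul, sqRate]
  congr 1
  field_simp

lemma expSummable_pairRate {c d : ℝ} (hc : 0 < c) (hd : 0 < d) (h k : ℝ) :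
    ExpSummable (pairRate c h d k) :=
  (expSummable_sqRate hc h).prod (expSummable_sqRate hd k)

lemma expSummable_latticeRate {a₁ a₂ a₃ : ℝ} (ha₁ : 0 < a₁) (ha₂ : 0 < a₂) (ha₃ : 0 < a₃) :
    ExpSummable (latticeRate a₁ a₂ a₃) :=
  (expSummable_sqRate ha₁ 0).prod (expSummable_pairRate ha₂ ha₃ 0 0)

lemma tsum_rectLattice {a₁ a₂ a₃ : ℝ} (ha₁ : a₁ ≠ 0) (ha₂ : a₂ ≠ 0) (ha₃ : a₃ ≠ 0) (x : ℝ) :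
    ∑' v : rectLattice a₁ a₂ a₃, exp (-‖(v : EuclideanSpace ℝ (Fin 3))‖ ^ 2 * x) =
      expSum (latticeRate a₁ a₂ a₃) x := by
  let g : ℤ × ℤ × ℤ → EuclideanSpace ℝ (Fin 3) := fun m =>
    (WithLp.equiv 2 (Fin 3 → ℝ)).symm ![a₁ * m.1, a₂ * m.2.1, a₃ * m.2.2]
  have hg : Function.Injective g := by
    rintro ⟨m, n, k⟩ ⟨m', n', k'⟩ h
    have h := (WithLp.equiv 2 (Fin 3 → ℝ)).symm.injective h
    have h0 := congrFun h 0
    have h1 := congrFun h 1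
    have h2 := congrFun h 2
    simp_all
  have hr : rectLattice a₁ a₂ a₃ = Set.range g := by
    ext v
    simp only [rectLattice, Set.mem_ofPred_eq, Set.mem_range, g, eq_comm]
  rw [hr, tsum_range (fun v => exp (-‖v‖ ^ 2 * x)) hg]
  refine tsum_congr fun m => ?_
  rw [EuclideanSpace.norm_sq_eq, Fin.sum_univ_three]
  simp [g, latticeRate, pairRate, sqRate, mul_pow, add_assoc]

lemma N4trace_eq {a₁ a₂ a₃ s : ℝ} (ha₁ : 0 < a₁) (ha₂ : 0 < a₂) (ha₃ : 0 < a₃) (hs : 0 < s) :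
    N4trace a₁ a₂ a₃ (1 / (4 * s ^ 2)) =
      1 / (4 * √π) * (s ^ 1 * (a₁ * expSum (sqRate a₁ (1 / 2)) (s ^ 2))) +
      (1 / (4 * π) * (s ^ 2 * (a₁ * a₂ * expSum (pairRate a₁ 0 a₂ (1 / 2)) (s ^ 2) +
        a₁ * a₃ * expSum (pairRate a₁ (1 / 2) a₃ (1 / 2)) (s ^ 2))) +
      1 / (4 * π ^ (3 / 2 : ℝ)) *
        (s ^ 3 * (a₁ * a₂ * a₃ * expSum (latticeRate a₁ a₂ a₃) (s ^ 2)))) := by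
  have ht : 4 * (1 / (4 * s ^ 2)) = (s ^ 2)⁻¹ := by field_simp
  have hsqrt : √(π * (1 / (4 * s ^ 2))) = √π / (2 * s) := by
    rw [sqrt_mul pi_pos.le, sqrt_div zero_le_one, sqrt_one,
      show (4 : ℝ) * s ^ 2 = (2 * s) ^ 2 by ring, sqrt_sq (by positivity), mul_one_div]
  have hrpow : (4 * π * (1 / (4 * s ^ 2))) ^ (3 / 2 : ℝ) = π ^ (3 / 2 : ℝ) / s ^ 3 := by
    rw [show 4 * π * (1 / (4 * s ^ 2)) = π / s ^ 2 by field_simp,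
      div_rpow pi_pos.le (by positivity), ← rpow_natCast s 2, ← rpow_mul hs.le, ← rpow_natCast s 3]
    norm_num
  simp only [N4trace, ht, hsqrt, hrpow, div_inv_eq_mul, tsum_rectLattice ha₁.ne' ha₂.ne' ha₃.ne']
  have h₁ : ∑' m : ℤ, exp (-((m : ℝ) + 1 / 2) ^ 2 * a₁ ^ 2 * s ^ 2) =
      expSum (sqRate a₁ (1 / 2)) (s ^ 2) :=
    tsum_congr fun m => by rw [sqRate]; ring_nf
  have h₂ : ∑' p : ℤ × ℤ, exp (-(a₁ ^ 2 * (p.1 : ℝ) ^ 2 + a₂ ^ 2 * ((p.2 : ℝ) + 1 / 2) ^ 2) *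
      s ^ 2) = expSum (pairRate a₁ 0 a₂ (1 / 2)) (s ^ 2) :=
    tsum_congr fun p => by rw [pairRate, sqRate, sqRate, add_zero]
  have h₃ : ∑' p : ℤ × ℤ, exp (-(a₁ ^ 2 * ((p.1 : ℝ) + 1 / 2) ^ 2 +
      a₃ ^ 2 * ((p.2 : ℝ) + 1 / 2) ^ 2) * s ^ 2) =
        expSum (pairRate a₁ (1 / 2) a₃ (1 / 2)) (s ^ 2) := rfl
  rw [h₁, h₂, h₃]
  field_simp
  ring

lemma isDirichletSeries_sqRate {a₁ : ℝ} (ha₁ : 0 < a₁) :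
    IsDirichletSeries (fun r => a₁ * fiberCard (sqRate a₁ (1 / 2)) r)
      (fun x => a₁ * expSum (sqRate a₁ (1 / 2)) x) :=
  (expSummable_sqRate ha₁ _).isDirichletSeries.const_mul _

lemma isDirichletSeries_pairRate {a₁ a₂ a₃ : ℝ} (ha₁ : 0 < a₁) (ha₂ : 0 < a₂) (ha₃ : 0 < a₃) :
    IsDirichletSeries
      (fun r => a₁ * a₂ * fiberCard (pairRate a₁ 0 a₂ (1 / 2)) r +
        a₁ * a₃ * fiberCard (pairRate a₁ (1 / 2) a₃ (1 / 2)) r)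
      (fun x => a₁ * a₂ * expSum (pairRate a₁ 0 a₂ (1 / 2)) x +
        a₁ * a₃ * expSum (pairRate a₁ (1 / 2) a₃ (1 / 2)) x) :=
  ((expSummable_pairRate ha₁ ha₂ _ _).isDirichletSeries.const_mul _).add
    ((expSummable_pairRate ha₁ ha₃ _ _).isDirichletSeries.const_mul _)

lemma isDirichletSeries_latticeRate {a₁ a₂ a₃ : ℝ} (ha₁ : 0 < a₁) (ha₂ : 0 < a₂) (ha₃ : 0 < a₃) :
    IsDirichletSeries (fun r => a₁ * a₂ * a₃ * fiberCard (latticeRate a₁ a₂ a₃) r)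
      (fun x => a₁ * a₂ * a₃ * expSum (latticeRate a₁ a₂ a₃) x) :=
  (expSummable_latticeRate ha₁ ha₂ ha₃).isDirichletSeries.const_mul _

lemma IsDirichletSeries.coeff_eq {N M f g : ℝ → ℝ} (hf : IsDirichletSeries N f)
    (hg : IsDirichletSeries M g) (h : ∀ x, 0 < x → f x = g x) (r : ℝ) : N r = M r :=
  sub_eq_zero.1 (congrFun ((hf.sub hg).coeff_eq_zero fun x hx => sub_eq_zero.2 (h x hx)) r)

lemma fiberCard_nonneg {ι : Type*} (μ : ι → ℝ) (r : ℝ) : 0 ≤ fiberCard μ r := Nat.cast_nonneg _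

lemma one_quarter_le_add_half_sq (m : ℤ) : (1 / 4 : ℝ) ≤ ((m : ℝ) + 1 / 2) ^ 2 := by
  have : (0 : ℝ) ≤ m * (m + 1) := by
    exact_mod_cast (by rcases le_or_gt 0 m with h | h <;> nlinarith : 0 ≤ m * (m + 1))
  nlinarith

/-- Equality of the three Dirichlet series making up the traces of two manifolds. -/
lemma expSum_eq_of_N4trace_eq {a₁ a₂ a₃ b₁ b₂ b₃ : ℝ}
    (ha₁ : 0 < a₁) (ha₂ : 0 < a₂) (ha₃ : 0 < a₃) (hb₁ : 0 < b₁) (hb₂ : 0 < b₂) (hb₃ : 0 < b₃)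
    (heq : ∀ t : ℝ, 0 < t → N4trace a₁ a₂ a₃ t = N4trace b₁ b₂ b₃ t) :
    (∀ x, 0 < x → a₁ * expSum (sqRate a₁ (1 / 2)) x = b₁ * expSum (sqRate b₁ (1 / 2)) x) ∧
    (∀ x, 0 < x →
      a₁ * a₂ * expSum (pairRate a₁ 0 a₂ (1 / 2)) x +
        a₁ * a₃ * expSum (pairRate a₁ (1 / 2) a₃ (1 / 2)) x =
      b₁ * b₂ * expSum (pairRate b₁ 0 b₂ (1 / 2)) x +
        b₁ * b₃ * expSum (pairRate b₁ (1 / 2) b₃ (1 / 2)) x) ∧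
    ∀ x, 0 < x → a₁ * a₂ * a₃ * expSum (latticeRate a₁ a₂ a₃) x =
      b₁ * b₂ * b₃ * expSum (latticeRate b₁ b₂ b₃) x := by
  obtain ⟨z₁, z₂, z₃⟩ := IsDirichletSeries.eq_zero_of_pow_mul_add_eq_zero
    (((isDirichletSeries_sqRate ha₁).sub (isDirichletSeries_sqRate hb₁)).const_mul (1 / (4 * √π)))
    (((isDirichletSeries_pairRate ha₁ ha₂ ha₃).sub
      (isDirichletSeries_pairRate hb₁ hb₂ hb₃)).const_mul (1 / (4 * π)))
    (((isDirichletSeries_latticeRate ha₁ ha₂ ha₃).sub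
      (isDirichletSeries_latticeRate hb₁ hb₂ hb₃)).const_mul (1 / (4 * π ^ (3 / 2 : ℝ))))
    (fun s hs => by
      have h := heq (1 / (4 * s ^ 2)) (by positivity)
      rw [N4trace_eq ha₁ ha₂ ha₃ hs, N4trace_eq hb₁ hb₂ hb₃ hs] at h
      linear_combination h)
  have hπ := pi_pos
  refine ⟨fun x hx => ?_, fun x hx => ?_, fun x hx => ?_⟩
  · exact sub_eq_zero.1 ((mul_eq_zero.1 (z₁ x hx)).resolve_left (by positivity))
  · exact sub_eq_zero.1 ((mul_eq_zero.1 (z₂ x hx)).resolve_left (by positivity))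
  · exact sub_eq_zero.1 ((mul_eq_zero.1 (z₃ x hx)).resolve_left (by positivity))

lemma le_of_expSum_sqRate_eq {a b : ℝ} (ha : 0 < a) (hb : 0 < b)
    (h : ∀ x, 0 < x → a * expSum (sqRate a (1 / 2)) x = b * expSum (sqRate b (1 / 2)) x) :
    b ≤ a := by
  have hc := (isDirichletSeries_sqRate ha).coeff_eq (isDirichletSeries_sqRate hb) h (a ^ 2 / 4)
  have hpos : fiberCard (sqRate a (1 / 2)) (a ^ 2 / 4) ≠ 0 :=
    (expSummable_sqRate ha _).fiberCard_ne_zero_iff.2 ⟨0, by simp [sqRate]; ring⟩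
  have hb' : fiberCard (sqRate b (1 / 2)) (a ^ 2 / 4) ≠ 0 :=
    right_ne_zero_of_mul (hc ▸ mul_ne_zero ha.ne' hpos)
  obtain ⟨m, hm⟩ := (expSummable_sqRate hb _).fiberCard_ne_zero_iff.1 hb'
  rw [sqRate] at hm
  refine le_of_sq_le_sq ?_ ha.le
  nlinarith [one_quarter_le_add_half_sq m, sq_nonneg b]

lemma fiberCard_latticeRate_zero {a₁ a₂ a₃ : ℝ} (ha₁ : 0 < a₁) (ha₂ : 0 < a₂) (ha₃ : 0 < a₃) :
    fiberCard (latticeRate a₁ a₂ a₃) 0 = 1 := by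
  have : latticeRate a₁ a₂ a₃ ⁻¹' {0} = {0} := by
    ext ⟨m, n, k⟩
    simp only [Set.mem_preimage, Set.mem_singleton_iff, latticeRate, pairRate, sqRate, add_zero]
    rw [add_eq_zero_iff_of_nonneg (by positivity) (by positivity),
      add_eq_zero_iff_of_nonneg (by positivity) (by positivity)]
    simp [ha₁.ne', ha₂.ne', ha₃.ne']
  simp [fiberCard, this]

lemma min_le_min_of_expSum_pairRate_eq {a b c d : ℝ} (ha : 0 < a) (hb : 0 < b) (hc : 0 < c)
    (hd : 0 < d)
    (h : ∀ x, 0 < x → expSum (pairRate a 0 b 0) x = expSum (pairRate c 0 d 0) x) :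
    min c d ≤ min a b := by
  have of_mem : ∀ e, 0 < e → (∃ p, pairRate a 0 b 0 p = e ^ 2) → min c d ≤ e := by
    intro e he hp
    have heq := (expSummable_pairRate ha hb 0 0).isDirichletSeries.coeff_eq
      (expSummable_pairRate hc hd 0 0).isDirichletSeries h (e ^ 2)
    have hne := (expSummable_pairRate ha hb 0 0).fiberCard_ne_zero_iff.2 hp
    rw [heq] at hne
    obtain ⟨⟨m, n⟩, hmn⟩ := (expSummable_pairRate hc hd 0 0).fiberCard_ne_zero_iff.1 hne
    simp only [pairRate, sqRate, add_zero] at hmn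
    have one_le_sq : ∀ k : ℤ, k ≠ 0 → (1 : ℝ) ≤ (k : ℝ) ^ 2 := fun k hk => by
      exact_mod_cast Int.add_one_le_of_lt (sq_pos_of_ne_zero hk)
    by_cases hm : m = 0
    · have hn : n ≠ 0 := by
        rintro rfl
        simp [hm] at hmn
        exact (pow_pos he 2).ne hmn
      refine (min_le_right c d).trans (le_of_sq_le_sq ?_ he.le)
      nlinarith [one_le_sq n hn, sq_nonneg d, mul_nonneg (sq_nonneg c) (sq_nonneg (m : ℝ))]
    · refine (min_le_left c d).trans (le_of_sq_le_sq ?_ he.le)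
      nlinarith [one_le_sq m hm, sq_nonneg c, mul_nonneg (sq_nonneg d) (sq_nonneg (n : ℝ))]
  exact le_min (of_mem a ha ⟨(1, 0), by simp [pairRate, sqRate]⟩)
    (of_mem b hb ⟨(0, 1), by simp [pairRate, sqRate]⟩)

/-- Interchanging the last two parameters changes the part of the trace of weight `t⁻¹`. -/
lemma le_of_expSum_pairRate_swap {a b c : ℝ} (ha : 0 < a) (hb : 0 < b) (hc : 0 < c)
    (h : ∀ x, 0 < x →
      a * b * expSum (pairRate a 0 b (1 / 2)) x +
        a * c * expSum (pairRate a (1 / 2) c (1 / 2)) x =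
      a * c * expSum (pairRate a 0 c (1 / 2)) x +
        a * b * expSum (pairRate a (1 / 2) b (1 / 2)) x) : c ≤ b := by
  have heq := (isDirichletSeries_pairRate ha hb hc).coeff_eq
    (isDirichletSeries_pairRate ha hc hb) h (b ^ 2 / 4)
  have hne : fiberCard (pairRate a 0 b (1 / 2)) (b ^ 2 / 4) ≠ 0 :=
    (expSummable_pairRate ha hb _ _).fiberCard_ne_zero_iff.2
      ⟨(0, 0), by simp [pairRate, sqRate]; ring⟩
  have hpos := mul_pos (mul_pos ha hb) (lt_of_le_of_ne (fiberCard_nonneg _ _) hne.symm)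
  have hnn := mul_nonneg (mul_pos ha hc).le
    (fiberCard_nonneg (pairRate a (1 / 2) c (1 / 2)) (b ^ 2 / 4))
  have hor : fiberCard (pairRate a 0 c (1 / 2)) (b ^ 2 / 4) ≠ 0 ∨
      fiberCard (pairRate a (1 / 2) b (1 / 2)) (b ^ 2 / 4) ≠ 0 := by
    by_contra! hz
    simp only [hz.1, hz.2, mul_zero, add_zero] at heq
    linarith
  rcases hor with hz | hz
  · obtain ⟨⟨m, n⟩, hmn⟩ := (expSummable_pairRate ha hc _ _).fiberCard_ne_zero_iff.1 hz
    simp only [pairRate, sqRate, add_zero] at hmn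
    refine le_of_sq_le_sq ?_ hb.le
    nlinarith [one_quarter_le_add_half_sq n, sq_nonneg c,
      mul_nonneg (sq_nonneg a) (sq_nonneg (m : ℝ))]
  · obtain ⟨⟨m, n⟩, hmn⟩ := (expSummable_pairRate ha hb _ _).fiberCard_ne_zero_iff.1 hz
    simp only [pairRate, sqRate] at hmn
    nlinarith [mul_le_mul_of_nonneg_left (one_quarter_le_add_half_sq n) (sq_nonneg b),
      mul_le_mul_of_nonneg_left (one_quarter_le_add_half_sq m) (sq_nonneg a), sq_pos_of_pos ha]

lemma expSum_pairRate_eq_of_expSum_latticeRate_eq {a b c d e : ℝ} (ha : 0 < a) (hb : 0 < b)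
    (hc : 0 < c) (hd : 0 < d) (he : 0 < e)
    (h : ∀ x, 0 < x → a * b * c * expSum (latticeRate a b c) x =
      a * d * e * expSum (latticeRate a d e) x) :
    b * c = d * e ∧
      ∀ x, 0 < x → expSum (pairRate b 0 c 0) x = expSum (pairRate d 0 e 0) x := by
  have hvol := (isDirichletSeries_latticeRate ha hb hc).coeff_eq
    (isDirichletSeries_latticeRate ha hd he) h 0
  rw [fiberCard_latticeRate_zero ha hb hc, fiberCard_latticeRate_zero ha hd he, mul_one, mul_one]
    at hvol
  have hprod : ∀ {u v : ℝ}, 0 < u → 0 < v → ∀ {x : ℝ}, 0 < x → expSum (latticeRate a u v) x =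
      expSum (sqRate a 0) x * expSum (pairRate u 0 v 0) x := fun hu hv _ hx =>
    (expSummable_sqRate ha 0).expSum_prod (expSummable_pairRate hu hv 0 0) hx
  refine ⟨mul_left_cancel₀ ha.ne' (by linarith), fun x hx => ?_⟩
  have hx' := h x hx
  rw [hvol] at hx'
  have h3 := mul_left_cancel₀ (by positivity) hx'
  rw [hprod hb hc hx, hprod hd he hx] at h3
  exact mul_left_cancel₀ ((expSummable_sqRate ha 0).expSum_pos hx).ne' h3

/-- Case `N₄` of Theorem B: two flat 3-manifolds of type `N₄` with equal trace functions
have the same ordered triple of parameters. -/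
theorem N4_isospectral_implies_isometric
    (a₁ a₂ a₃ b₁ b₂ b₃ : ℝ)
    (ha₁ : 0 < a₁) (ha₂ : 0 < a₂) (ha₃ : 0 < a₃)
    (hb₁ : 0 < b₁) (hb₂ : 0 < b₂) (hb₃ : 0 < b₃)
    (heq : ∀ t : ℝ, 0 < t → N4trace a₁ a₂ a₃ t = N4trace b₁ b₂ b₃ t) :
    a₁ = b₁ ∧ a₂ = b₂ ∧ a₃ = b₃ := by
  obtain ⟨h₁, h₂, h₃⟩ := expSum_eq_of_N4trace_eq ha₁ ha₂ ha₃ hb₁ hb₂ hb₃ heq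
  obtain rfl : a₁ = b₁ := le_antisymm (le_of_expSum_sqRate_eq hb₁ ha₁ fun x hx => (h₁ x hx).symm)
    (le_of_expSum_sqRate_eq ha₁ hb₁ h₁)
  obtain ⟨hmul, hpair⟩ := expSum_pairRate_eq_of_expSum_latticeRate_eq ha₁ ha₂ ha₃ hb₂ hb₃ h₃
  have hmin : min a₂ a₃ = min b₂ b₃ := le_antisymm
    (min_le_min_of_expSum_pairRate_eq hb₂ hb₃ ha₂ ha₃ fun x hx => (hpair x hx).symm)
    (min_le_min_of_expSum_pairRate_eq ha₂ ha₃ hb₂ hb₃ hpair)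
  have hcases : (a₂ = b₂ ∧ a₃ = b₃) ∨ (a₂ = b₃ ∧ a₃ = b₂) := by
    rcases le_total a₂ a₃ with h | h <;> rcases le_total b₂ b₃ with h' | h' <;>
      simp only [min_eq_left, min_eq_right, h, h'] at hmin <;> subst hmin
    · exact Or.inl ⟨rfl, mul_left_cancel₀ ha₂.ne' hmul⟩
    · exact Or.inr ⟨rfl, mul_left_cancel₀ ha₂.ne' (by linarith)⟩
    · exact Or.inr ⟨mul_right_cancel₀ ha₃.ne' (by linarith), rfl⟩
    · exact Or.inl ⟨mul_right_cancel₀ ha₃.ne' hmul, rfl⟩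
  rcases hcases with h | ⟨rfl, rfl⟩
  · exact ⟨rfl, h⟩
  · have : a₂ = a₃ := le_antisymm
      (le_of_expSum_pairRate_swap ha₁ ha₃ ha₂ fun x hx => (h₂ x hx).symm)
      (le_of_expSum_pairRate_swap ha₁ ha₂ ha₃ h₂)
    exact ⟨rfl, this, this.symm⟩
end
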